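/- For every integer k ≥ 3 and every constant 1/k < η ≤ 1 there exists α > 0 such that the following holds for all sufficiently large n ∈ ℕ: every n-vertex graph G with minimum degree δ(G) ≥ ηn and α_{k−1}(G) ≤ αn contains a K_k-tiling covering all but at most ⌊1/η⌋(k−1) vertices of G (an η-quasiperfect K_k-tiling). -/

import Mathlib

open Finset

namespace RTT

variable {k n : ℕ}

/-- `S` spans a copy of the `k`-vertex graph `F` in `G`:
there is an injective graph homomorphism from `F` to `G` with image exactly `S`. -/
def SpansCopy (F : SimpleGraph (Fin k)) (G : SimpleGraph (Fin n))
    (S : Finset (Fin n)) : Prop :=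
  ∃ f : Fin k → Fin n, Function.Injective f ∧
    (∀ a b, F.Adj a b → G.Adj (f a) (f b)) ∧ Finset.image f Finset.univ = S

/-- `T` is an `F`-tiling in `G`: a collection of pairwise vertex-disjoint vertex sets,
each spanning a copy of `F`. -/
def IsTiling (F : SimpleGraph (Fin k)) (G : SimpleGraph (Fin n))
    (T : Finset (Finset (Fin n))) : Prop :=
  (∀ S ∈ T, SpansCopy F G S) ∧ ∀ S ∈ T, ∀ S' ∈ T, S ≠ S' → Disjoint S S'

/-- The induced subgraph of `G` on the vertex set `A` has a perfect `F`-tiling. -/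
def PerfTilingOn (F : SimpleGraph (Fin k)) (G : SimpleGraph (Fin n))
    (A : Finset (Fin n)) : Prop :=
  ∃ T : Finset (Finset (Fin n)), IsTiling F G T ∧ T.biUnion id = A

/-- The minimum degree of `G` is at least `x`. -/
def MinDegGE (G : SimpleGraph (Fin n)) (x : ℝ) : Prop :=
  ∀ v : Fin n, x ≤ ((G.neighborSet v).ncard : ℝ)

/-- The `r`-independence number of `G` is at most `x`: every vertex set whose induced
subgraph contains no copy of `K_r` has size at most `x`. -/
def IndepBound (G : SimpleGraph (Fin n)) (r : ℕ) (x : ℝ) : Prop :=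
  ∀ S : Finset (Fin n), (∀ T ⊆ S, ¬ G.IsNClique r T) → (S.card : ℝ) ≤ x

/-- `α*(G) ≤ x`: every bipartite hole of `G` has size at most `x`. -/
def HoleBound (G : SimpleGraph (Fin n)) (x : ℝ) : Prop :=
  ∀ (s : ℕ) (U₁ U₂ : Finset (Fin n)), Disjoint U₁ U₂ → U₁.card = s → U₂.card = s →
    (∀ u ∈ U₁, ∀ v ∈ U₂, ¬ G.Adj u v) → (s : ℝ) ≤ x

/-- `A` is a `ξ`-absorbing set with respect to `V'` (for the `k`-vertex graph `F`
in the `n`-vertex graph `G`). -/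
def IsAbsorbingSet (F : SimpleGraph (Fin k)) (G : SimpleGraph (Fin n)) (ξ : ℝ)
    (V' A : Finset (Fin n)) : Prop :=
  ∀ U : Finset (Fin n), U ⊆ V' \ A → (U.card : ℝ) ≤ ξ * n →
    k ∣ (A ∪ U).card → PerfTilingOn F G (A ∪ U)

/-- `A` is an `(F,t)`-absorber for the `k`-set `S`. -/
def IsAbsorber (F : SimpleGraph (Fin k)) (G : SimpleGraph (Fin n)) (t : ℕ)
    (S A : Finset (Fin n)) : Prop :=
  Disjoint A S ∧ A.card ≤ k ^ 2 * t ∧ PerfTilingOn F G A ∧ PerfTilingOn F G (A ∪ S)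

/-- `S` has a family of at least `x` pairwise vertex-disjoint `(F,t)`-absorbers in `G`. -/
def HasManyAbsorbers (F : SimpleGraph (Fin k)) (G : SimpleGraph (Fin n)) (t : ℕ)
    (S : Finset (Fin n)) (x : ℝ) : Prop :=
  ∃ 𝒜 : Finset (Finset (Fin n)), x ≤ (𝒜.card : ℝ) ∧
    (∀ A ∈ 𝒜, IsAbsorber F G t S A) ∧
    ∀ A ∈ 𝒜, ∀ A' ∈ 𝒜, A ≠ A' → Disjoint A A'

/-- `𝒮` is an `F`-fan at `v` in `U`: a collection of pairwise disjoint `(k-1)`-sets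
`S ⊆ U \ {v}` such that `{v} ∪ S` spans a copy of `F`; its size is `𝒮.card`. -/
def IsFan (F : SimpleGraph (Fin k)) (G : SimpleGraph (Fin n)) (v : Fin n)
    (U : Finset (Fin n)) (𝒮 : Finset (Finset (Fin n))) : Prop :=
  (∀ S ∈ 𝒮, S ⊆ U.erase v ∧ S.card = k - 1 ∧ SpansCopy F G (insert v S)) ∧
    ∀ S ∈ 𝒮, ∀ S' ∈ 𝒮, S ≠ S' → Disjoint S S'

/-- `u` and `v` are `(F, m, t)`-reachable in `G`. -/
def FReachable (F : SimpleGraph (Fin k)) (G : SimpleGraph (Fin n)) (m : ℝ) (t : ℕ)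
    (u v : Fin n) : Prop :=
  ∀ W : Finset (Fin n), (W.card : ℝ) ≤ m →
    ∃ S : Finset (Fin n), Disjoint S W ∧ u ∉ S ∧ v ∉ S ∧ S.card ≤ k * t - 1 ∧
      PerfTilingOn F G (insert u S) ∧ PerfTilingOn F G (insert v S)

/-- `U` is `(F, m, t)`-closed in `G`. -/
def FClosed (F : SimpleGraph (Fin k)) (G : SimpleGraph (Fin n)) (m : ℝ) (t : ℕ)
    (U : Finset (Fin n)) : Prop :=
  ∀ u ∈ U, ∀ v ∈ U, u ≠ v → FReachable F G m t u v

/-- `P` is a partition of the vertex set of an `n`-vertex graph into `C` parts. -/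
def IsPartition {C : ℕ} (P : Fin C → Finset (Fin n)) : Prop :=
  (∀ i j, i ≠ j → Disjoint (P i) (P j)) ∧ Finset.univ.biUnion P = Finset.univ

/-- The `k`-vector `v` is `(F, β)`-robust with respect to the partition `P`:
it has coordinate sum `k`, and avoiding any set `W` of at most `βn` vertices there is
a copy of `F` whose vertex set has index vector `v`. -/
def RobustVec (F : SimpleGraph (Fin k)) (G : SimpleGraph (Fin n)) {C : ℕ}
    (P : Fin C → Finset (Fin n)) (β : ℝ) (v : Fin C → ℕ) : Prop :=
  (∑ i, v i) = k ∧
    ∀ W : Finset (Fin n), (W.card : ℝ) ≤ β * n →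
      ∃ S : Finset (Fin n), Disjoint S W ∧ SpansCopy F G S ∧ ∀ i, (S ∩ P i).card = v i

end RTT


open Finset

namespace QT

set_option linter.unusedSectionVars false

variable {V : Type*} [Fintype V] [DecidableEq V]

noncomputable def nb (G : SimpleGraph V) (x : V) : Finset V :=
  by classical exact univ.filter (fun y => G.Adj x y)

theorem mem_nb {G : SimpleGraph V} {x y : V} : y ∈ nb G x ↔ G.Adj x y := by
  classical
  simp [nb]

/-- `A` is perfectly tiled by `k`-cliques. -/
def Til (G : SimpleGraph V) (k : ℕ) (A : Finset V) : Prop :=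
  ∃ T : Finset (Finset V), (∀ S ∈ T, G.IsNClique k S) ∧
    (∀ S ∈ T, ∀ S' ∈ T, S ≠ S' → Disjoint S S') ∧ T.biUnion id = A

theorem til_empty (G : SimpleGraph V) (k : ℕ) : Til G k ∅ := ⟨∅, by simp⟩

theorem til_clique {G : SimpleGraph V} {k : ℕ} {A : Finset V} (h : G.IsNClique k A) :
    Til G k A := ⟨{A}, by simpa using h, by simp, by simp⟩

theorem til_union {G : SimpleGraph V} {k : ℕ} {A B : Finset V} (hA : Til G k A)
    (hB : Til G k B) (hd : Disjoint A B) : Til G k (A ∪ B) := by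
  obtain ⟨T, h1, h2, h3⟩ := hA
  obtain ⟨T', h1', h2', h3'⟩ := hB
  have sub : ∀ S ∈ T, S ⊆ A := fun S hS => h3 ▸ Finset.subset_biUnion_of_mem id hS
  have sub' : ∀ S ∈ T', S ⊆ B := fun S hS => h3' ▸ Finset.subset_biUnion_of_mem id hS
  refine ⟨T ∪ T', ?_, ?_, ?_⟩
  · intro S hS
    rcases Finset.mem_union.1 hS with h | h
    · exact h1 S h
    · exact h1' S h
  · intro S hS S' hS' hne
    rcases Finset.mem_union.1 hS with h | h <;> rcases Finset.mem_union.1 hS' with h' | h'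
    · exact h2 S h S' h' hne
    · exact disjoint_of_subset_left (sub S h) (disjoint_of_subset_right (sub' S' h') hd)
    · exact (disjoint_of_subset_left (sub S' h') (disjoint_of_subset_right (sub' S h) hd)).symm
    · exact h2' S h S' h' hne
  · rw [← h3, ← h3']
    ext x; simp only [mem_biUnion, mem_union, id]; aesop

theorem til_biUnion {G : SimpleGraph V} {k : ℕ} {ι : Type*} [DecidableEq ι] (s : Finset ι)
    (f : ι → Finset V) (h : ∀ i ∈ s, Til G k (f i))
    (hd : ∀ i ∈ s, ∀ j ∈ s, i ≠ j → Disjoint (f i) (f j)) : Til G k (s.biUnion f) := by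
  induction s using Finset.induction_on with
  | empty => simpa using til_empty G k
  | insert a s ha ih =>
    rw [Finset.biUnion_insert]
    refine til_union (h a (by simp)) (ih (fun i hi => h i (by simp [hi]))
      (fun i hi j hj => hd i (by simp [hi]) j (by simp [hj]))) ?_
    rw [Finset.disjoint_biUnion_right]
    intro i hi
    exact hd a (by simp) i (by simp [hi]) (by rintro rfl; exact ha hi)

/-- `S` connects `x` and `y`. -/
def CB (G : SimpleGraph V) (k : ℕ) (S : Finset V) (x y : V) : Prop :=
  x ∉ S ∧ y ∉ S ∧ Til G k (insert x S) ∧ Til G k (insert y S)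

theorem CB.symm {G : SimpleGraph V} {k : ℕ} {S : Finset V} {x y : V} (h : CB G k S x y) :
    CB G k S y x := ⟨h.2.1, h.1, h.2.2.2, h.2.2.1⟩

theorem CB.comp {G : SimpleGraph V} {k : ℕ} {S S' : Finset V} {x y z : V}
    (h : CB G k S x z) (h' : CB G k S' z y) (hd : Disjoint S S') (hx : x ∉ S') (hy : y ∉ S)
    (hxz : x ≠ z) (hzy : z ≠ y) : CB G k (insert z (S ∪ S')) x y := by
  obtain ⟨a1, a2, a3, a4⟩ := h
  obtain ⟨b1, b2, b3, b4⟩ := h'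
  have hd' := Finset.disjoint_left.1 hd
  refine ⟨by simp [*], by simp [*, Ne.symm hzy], ?_, ?_⟩
  · have := til_union a3 b3 (by
      rw [Finset.disjoint_left]; intro w hw hw'
      simp only [mem_insert] at hw hw'
      rcases hw with rfl | hw <;> rcases hw' with rfl | hw'
      · exact hxz rfl
      · exact hx hw'
      · exact a2 hw
      · exact hd' hw hw')
    convert this using 1
    ext w; simp only [mem_insert, mem_union]; tauto
  · have := til_union a4 b4 (by
      rw [Finset.disjoint_left]; intro w hw hw'
      simp only [mem_insert] at hw hw'
      rcases hw with rfl | hw <;> rcases hw' with rfl | hw'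
      · exact hzy rfl
      · exact b1 hw'
      · exact hy hw
      · exact hd' hw hw')
    convert this using 1
    ext w; simp only [mem_insert, mem_union]; tauto

/-- robust reachability -/
def R (G : SimpleGraph V) (k c m : ℕ) (x y : V) : Prop :=
  ∀ W : Finset V, W.card ≤ m → ∃ S : Finset V, S.card ≤ c ∧ Disjoint S W ∧ CB G k S x y

theorem R.symm {G : SimpleGraph V} {k c m : ℕ} {x y : V} (h : R G k c m x y) :
    R G k c m y x := fun W hW => by
  obtain ⟨S, h1, h2, h3⟩ := h W hW
  exact ⟨S, h1, h2, h3.symm⟩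

theorem R.mono {G : SimpleGraph V} {k c m c' m' : ℕ} {x y : V} (h : R G k c m x y)
    (hc : c ≤ c') (hm : m' ≤ m) : R G k c' m' x y := fun W hW => by
  obtain ⟨S, h1, h2, h3⟩ := h W (hW.trans hm)
  exact ⟨S, h1.trans hc, h2, h3⟩

theorem levels (Rt : ℕ → V → V → Prop) (r : ℕ)
    (h0 : ∀ E : Finset V, E.card = r + 1 → ∃ x ∈ E, ∃ y ∈ E, x ≠ y ∧ Rt 0 x y) :
    ∃ t ≤ r, ∃ D : Finset V, D.card ≤ r ∧
      (∀ x ∈ D, ∀ y ∈ D, x ≠ y → ¬ Rt (t+1) x y) ∧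
      (∀ E : Finset V, E.card = D.card + 1 → ∃ x ∈ E, ∃ y ∈ E, x ≠ y ∧ Rt t x y) := by
  by_contra hcon
  push Not at hcon
  have key : ∀ d ≤ r + 1, ∃ D : Finset V, D.card = d ∧
      ∀ x ∈ D, ∀ y ∈ D, x ≠ y → ¬ Rt (r + 1 - d) x y := by
    intro d
    induction d with
    | zero => intro _; exact ⟨∅, by simp⟩
    | succ d ih =>
      intro hd
      obtain ⟨D, hD, hD'⟩ := ih (by omega)
      obtain ⟨E, hE, hE'⟩ := hcon (r - d) (by omega) D (by omega) (by
        rw [show r - d + 1 = r + 1 - d by omega]; exact hD')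
      refine ⟨E, by omega, ?_⟩
      rw [show r + 1 - (d + 1) = r - d by omega]; exact hE'
  obtain ⟨D, hD, hD'⟩ := key (r+1) le_rfl
  obtain ⟨x, hx, y, hy, hne, h⟩ := h0 D hD
  apply hD' x hx y hy hne
  simpa using h

/-- the structural lemma -/
theorem structure_lemma (G : SimpleGraph V) (q r c m c' m' : ℕ) (D : Finset V)
    (hDr : D.card ≤ r)
    (hc : 2 * c + q + 2 ≤ c') (hm : m' + c + q + 4 ≤ m)
    (hD1 : ∀ x ∈ D, ∀ y ∈ D, x ≠ y → ¬ R G (q+1) c' m' x y)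
    (hD2 : ∀ E : Finset V, E.card = D.card + 1 → ∃ x ∈ E, ∃ y ∈ E, x ≠ y ∧ R G (q+1) c m x y) :
    ∃ (Ws : Finset V) (cl : V → V), Ws.card ≤ r * r * m' + r ∧ (∀ x ∉ Ws, cl x ∈ D) ∧
      (∀ x ∉ Ws, ∀ y ∉ Ws, x ≠ y → cl x = cl y → R G (q+1) c m x y) ∧
      (∀ x ∉ Ws, ∀ y ∉ Ws, ∀ S : Finset V, S.card ≤ q → Disjoint S Ws → CB G (q+1) S x y →
        cl x = cl y) := by
  classical
  have hW : ∀ x y, ∃ W : Finset V, W.card ≤ m' ∧ (x ∈ D → y ∈ D → x ≠ y →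
      ∀ S : Finset V, S.card ≤ c' → Disjoint S W → ¬ CB G (q+1) S x y) := by
    intro x y
    by_cases h : x ∈ D ∧ y ∈ D ∧ x ≠ y
    · have := hD1 x h.1 y h.2.1 h.2.2
      unfold R at this
      push Not at this
      obtain ⟨W, h1, h2⟩ := this
      exact ⟨W, h1, fun _ _ _ => h2⟩
    · exact ⟨∅, by simp, fun a b c => absurd ⟨a, b, c⟩ h⟩
  choose Wf hW1 hW2 using hW
  set Ws : Finset V := D ∪ (D ×ˢ D).biUnion (fun p => Wf p.1 p.2) with hWs
  have hWfs : ∀ x ∈ D, ∀ y ∈ D, Wf x y ⊆ Ws := by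
    intro x hx y hy
    refine subset_trans ?_ subset_union_right
    exact Finset.subset_biUnion_of_mem (fun p : V × V => Wf p.1 p.2) (mk_mem_product hx hy)
  have hDW : D ⊆ Ws := subset_union_left
  -- two-step contradiction
  have two : ∀ v ∈ D, ∀ v' ∈ D, v ≠ v' → ∀ x ∉ Ws, R G (q+1) c m v x → R G (q+1) c m x v' → False := by
    intro v hv v' hv' hne x hx h1 h2
    have hxv : v ≠ x := by rintro rfl; exact hx (hDW hv)
    have hxv' : x ≠ v' := by rintro rfl; exact hx (hDW hv')
    obtain ⟨S, s1, s2, s3⟩ := h1 (insert v' (Wf v v')) (by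
      have := card_insert_le v' (Wf v v'); have := hW1 v v'; omega)
    obtain ⟨S', s1', s2', s3'⟩ := h2 (insert v (Wf v v' ∪ S)) (by
      have := card_insert_le v (Wf v v' ∪ S); have := card_union_le (Wf v v') S
      have := hW1 v v'; omega)
    rw [disjoint_insert_right] at s2 s2'
    rw [disjoint_union_right] at s2'
    refine hW2 v v' hv hv' hne (insert x (S ∪ S')) ?_ ?_
      (s3.comp s3' s2'.2.2.symm s2'.1 s2.1 hxv hxv')
    · have := card_insert_le x (S ∪ S'); have := card_union_le S S'; omega
    · rw [disjoint_insert_left, disjoint_union_left]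
      exact ⟨fun h => hx (hWfs v hv v' hv' h), s2.2, s2'.2.1⟩
  have hcl : ∀ x, ∃ v, x ∉ Ws → v ∈ D ∧ R G (q+1) c m v x := by
    intro x
    by_cases hx : x ∈ Ws
    · exact ⟨x, fun h => absurd hx h⟩
    have hxD : x ∉ D := fun h => hx (hDW h)
    obtain ⟨a, ha, b, hb, hab, hR⟩ := hD2 (insert x D) (by simp [hxD])
    rw [mem_insert] at ha hb
    rcases ha with rfl | ha <;> rcases hb with rfl | hb
    · exact absurd rfl hab
    · exact ⟨b, fun _ => ⟨hb, hR.symm⟩⟩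
    · exact ⟨a, fun _ => ⟨ha, hR⟩⟩
    · exact absurd (hR.mono (by omega) (by omega)) (hD1 a ha b hb hab)
  choose cl hcl using hcl
  refine ⟨Ws, cl, ?_, fun x hx => (hcl x hx).1, ?_, ?_⟩
  · have h1 := card_union_le D ((D ×ˢ D).biUnion (fun p => Wf p.1 p.2))
    have h2 : ((D ×ˢ D).biUnion (fun p => Wf p.1 p.2)).card ≤ (D ×ˢ D).card * m' :=
      card_biUnion_le_card_mul _ _ _ (fun p _ => hW1 _ _)
    rw [card_product] at h2
    have h3 : D.card * D.card * m' ≤ r * r * m' := by gcongr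
    rw [← hWs] at h1
    omega
  · intro x hx y hy hxy he
    obtain ⟨hv, hvx⟩ := hcl x hx
    obtain ⟨hv', hvy⟩ := hcl y hy
    rw [← he] at hvy hv'
    have hxD : x ∉ D := fun h => hx (hDW h)
    have hyD : y ∉ D := fun h => hy (hDW h)
    obtain ⟨a, ha, b, hb, hab, hR⟩ := hD2 (insert x (insert y (D.erase (cl x)))) (by
      rw [card_insert_of_notMem (by simp [hxD, hxy]), card_insert_of_notMem (by simp [hyD]),
        card_erase_of_mem hv]
      have := card_pos.2 ⟨_, hv⟩
      omega)
    simp only [mem_insert, mem_erase] at ha hb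
    rcases ha with rfl | rfl | ha <;> rcases hb with rfl | rfl | hb
    · exact absurd rfl hab
    · exact hR
    · exact (two _ hv b hb.2 (Ne.symm hb.1) _ hx hvx hR).elim
    · exact hR.symm
    · exact absurd rfl hab
    · exact (two _ hv b hb.2 (Ne.symm hb.1) _ hy hvy hR).elim
    · exact (two _ hv a ha.2 (Ne.symm ha.1) _ hx hvx hR.symm).elim
    · exact (two _ hv a ha.2 (Ne.symm ha.1) _ hy hvy hR.symm).elim
    · exact absurd (hR.mono (by omega) (by omega)) (hD1 a ha.2 b hb.2 hab)
  · intro x hx y hy S hS hSW hCB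
    by_contra hne
    obtain ⟨hv, hvx⟩ := hcl x hx
    obtain ⟨hv', hvy⟩ := hcl y hy
    have hxy : x ≠ y := by rintro rfl; exact hne rfl
    set v := cl x
    set v' := cl y
    have nWs : ∀ z ∈ D, ∀ w ∉ Ws, z ≠ w := by
      rintro z hz w hw rfl; exact hw (hDW hz)
    have hSD : ∀ z ∈ D, z ∉ S := fun z hz h => disjoint_left.1 hSW h (hDW hz)
    obtain ⟨S1, s1, s2, s3⟩ := hvx (insert v' (insert y (Wf v v' ∪ S))) (by
      have := card_insert_le v' (insert y (Wf v v' ∪ S))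
      have := card_insert_le y (Wf v v' ∪ S)
      have := card_union_le (Wf v v') S; have := hW1 v v'; omega)
    simp only [disjoint_insert_right, disjoint_union_right] at s2
    have c1 := s3.comp hCB s2.2.2.2 (hSD v hv) s2.2.1 (nWs v hv x hx) hxy
    obtain ⟨S2, t1, t2, t3⟩ := hvy.symm (insert v (Wf v v' ∪ insert x (S1 ∪ S))) (by
      have := card_insert_le v (Wf v v' ∪ insert x (S1 ∪ S))
      have := card_union_le (Wf v v') (insert x (S1 ∪ S))
      have := card_insert_le x (S1 ∪ S)
      have := card_union_le S1 S; have := hW1 v v'; omega)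
    simp only [disjoint_insert_right, disjoint_union_right] at t2
    have c2 := c1.comp t3 (by
        simp only [disjoint_insert_left, disjoint_union_left]
        exact ⟨t2.2.2.1, t2.2.2.2.1.symm, t2.2.2.2.2.symm⟩) t2.1 (by
        simp only [mem_insert, mem_union, not_or]
        exact ⟨nWs v' hv' x hx, s2.1, hSD v' hv'⟩) (nWs v hv y hy) (nWs v' hv' y hy).symm
    refine hW2 v v' hv hv' hne _ ?_ ?_ c2
    · have := card_insert_le y (insert x (S1 ∪ S) ∪ S2)
      have := card_union_le (insert x (S1 ∪ S)) S2
      have := card_insert_le x (S1 ∪ S)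
      have := card_union_le S1 S; omega
    · have hsub := hWfs v hv v' hv'
      simp only [disjoint_insert_left, disjoint_union_left]
      exact ⟨fun h => hy (hsub h), ⟨fun h => hx (hsub h), s2.2.2.1,
        disjoint_of_subset_right hsub hSW⟩, t2.2.1⟩

end QT

open Finset
namespace QT
set_option linter.unusedSectionVars false
variable {V : Type*} [Fintype V] [DecidableEq V]

theorem greedy {ι : Type*} [DecidableEq ι] (P : ι → Finset V → Prop) (c M : ℕ) (W0 : Finset V)
    (s : Finset ι) (hM : W0.card + s.card * c ≤ M)
    (h : ∀ i ∈ s, ∀ W : Finset V, W.card ≤ M → ∃ S : Finset V, S.card ≤ c ∧ Disjoint S W ∧ P i S) :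
    ∃ f : ι → Finset V, (∀ i ∈ s, (f i).card ≤ c ∧ Disjoint (f i) W0 ∧ P i (f i)) ∧
      ∀ i ∈ s, ∀ j ∈ s, i ≠ j → Disjoint (f i) (f j) := by
  induction s using Finset.induction_on with
  | empty => exact ⟨fun _ => ∅, by simp⟩
  | insert a s ha ih =>
    rw [card_insert_of_notMem ha] at hM
    obtain ⟨f, hf, hd⟩ := ih (by nlinarith) (fun i hi => h i (by simp [hi]))
    obtain ⟨S, h1, h2, h3⟩ := h a (by simp) (W0 ∪ s.biUnion f) (by
      have := card_union_le W0 (s.biUnion f)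
      have := card_biUnion_le_card_mul s f c (fun i hi => (hf i hi).1)
      nlinarith)
    rw [disjoint_union_right, disjoint_biUnion_right] at h2
    have hne : ∀ i ∈ s, i ≠ a := by rintro i hi rfl; exact ha hi
    refine ⟨Function.update f a S, ?_, ?_⟩
    · intro i hi
      rcases mem_insert.1 hi with rfl | hi
      · simpa using ⟨h1, h2.1, h3⟩
      · rw [Function.update_of_ne (hne i hi)]; exact hf i hi
    · intro i hi j hj hij
      rcases mem_insert.1 hi with rfl | hi' <;> rcases mem_insert.1 hj with rfl | hj'
      · exact absurd rfl hij
      · rw [Function.update_self, Function.update_of_ne (hne j hj')]; exact h2.2 j hj'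
      · rw [Function.update_self, Function.update_of_ne (hne i hi')]; exact (h2.2 i hi').symm
      · rw [Function.update_of_ne (hne i hi'), Function.update_of_ne (hne j hj')]
        exact hd i hi' j hj' hij

theorem insert_clique {G : SimpleGraph V} {q : ℕ} {x : V} {S : Finset V} (hS : G.IsNClique q S)
    (h : S ⊆ nb G x) : G.IsNClique (q+1) (insert x S) :=
  hS.insert (fun _ hb => mem_nb.1 (h hb))

theorem notMem_nb {G : SimpleGraph V} {x : V} {S : Finset V} (h : S ⊆ nb G x) : x ∉ S :=
  fun hx => G.loopless.irrefl x (mem_nb.1 (h hx))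

theorem link_CB {G : SimpleGraph V} {q : ℕ} {x y : V} {S : Finset V} (hS : G.IsNClique q S)
    (hx : S ⊆ nb G x) (hy : S ⊆ nb G y) : CB G (q+1) S x y :=
  ⟨notMem_nb hx, notMem_nb hy, til_clique (insert_clique hS hx), til_clique (insert_clique hS hy)⟩

theorem avoid_clique {G : SimpleGraph V} {q a : ℕ}
    (hA : ∀ S : Finset V, a < S.card → ∃ T ⊆ S, G.IsNClique q T)
    (Y W : Finset V) (h : a + W.card < Y.card) :
    ∃ S ⊆ Y, Disjoint S W ∧ G.IsNClique q S := by
  obtain ⟨T, hT, hc⟩ := hA (Y \ W) (by have := le_card_sdiff W Y; omega)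
  exact ⟨T, hT.trans sdiff_subset, disjoint_of_subset_left hT sdiff_disjoint, hc⟩

theorem R_base {G : SimpleGraph V} {q a : ℕ}
    (hA : ∀ S : Finset V, a < S.card → ∃ T ⊆ S, G.IsNClique q T)
    (m : ℕ) (x y : V) (h : a + m < (nb G x ∩ nb G y).card) : R G (q+1) q m x y := by
  intro W hW
  obtain ⟨S, h1, h2, h3⟩ := avoid_clique hA (nb G x ∩ nb G y) W (by omega)
  rw [subset_inter_iff] at h1
  exact ⟨S, h3.card_eq.le, h2, link_CB h3 h1.1 h1.2⟩

/-- class hypothesis -/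
def Linked (G : SimpleGraph V) (q : ℕ) (Ws : Finset V) (cl : V → V) : Prop :=
  ∀ x ∉ Ws, ∀ y ∉ Ws, ∀ S : Finset V, S.card ≤ q → Disjoint S Ws → CB G (q+1) S x y → cl x = cl y

noncomputable def cls (cl : V → V) (W : Finset V) (i : V) : Finset V :=
  univ.filter (fun y => y ∉ W ∧ cl y = i)

theorem mem_cls {cl : V → V} {W : Finset V} {i y : V} : y ∈ cls cl W i ↔ y ∉ W ∧ cl y = i := by
  simp [cls]

theorem class_large {G : SimpleGraph V} {q a e b : ℕ} {Ws : Finset V} {cl : V → V}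
    (hA : ∀ S : Finset V, a < S.card → ∃ T ⊆ S, G.IsNClique q T)
    (hL : Linked G q Ws cl) (hae : a + Ws.card < e)
    (hF3 : ∀ x, b ≤ (univ.filter (fun y => e ≤ (nb G x ∩ nb G y).card)).card)
    (x : V) (hx : x ∉ Ws) (W : Finset V) (hW : Ws ⊆ W) : b ≤ (cls cl W (cl x)).card + W.card := by
  refine (hF3 x).trans ?_
  refine le_trans (card_le_card ?_) (card_union_le _ _)
  intro y hy
  rw [mem_filter] at hy
  by_cases hyW : y ∈ W
  · simp [hyW]
  · rw [mem_union, mem_cls]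
    refine Or.inl ⟨hyW, ?_⟩
    obtain ⟨S, h1, h2, h3⟩ := avoid_clique hA (nb G x ∩ nb G y) Ws (by omega)
    rw [subset_inter_iff] at h1
    exact (hL x hx y (fun h => hyW (hW h)) S h3.card_eq.le h2 (link_CB h3 h1.1 h1.2)).symm

theorem exists_nbr {G : SimpleGraph V} (a dm M : ℕ) (hdeg : ∀ x, dm ≤ (nb G x).card)
    (Y W : Finset V) (hWM : W.card ≤ M) (h : a * Fintype.card V < Y.card * (dm - M)) :
    ∃ w ∉ W, a < (nb G w ∩ Y).card := by
  classical
  by_contra hcon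
  push Not at hcon
  have key := sum_card_bipartiteAbove_eq_sum_card_bipartiteBelow (s := Y) (t := Wᶜ) (fun x y => G.Adj x y)
  have h1 : Y.card * (dm - M) ≤ ∑ y ∈ Y, (bipartiteAbove (fun x y => G.Adj x y) Wᶜ y).card := by
    rw [← smul_eq_mul]
    refine card_nsmul_le_sum _ _ _ (fun y _ => ?_)
    have : nb G y \ W ⊆ bipartiteAbove (fun x y => G.Adj x y) Wᶜ y := by
      intro z hz
      rw [mem_sdiff, mem_nb] at hz
      simp [bipartiteAbove, hz]
    have := card_le_card this
    have := le_card_sdiff W (nb G y)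
    have := hdeg y
    omega
  have h2 : ∑ w ∈ Wᶜ, (bipartiteBelow (fun x y => G.Adj x y) Y w).card ≤ (Wᶜ).card * a := by
    rw [← smul_eq_mul]
    refine sum_le_card_nsmul _ _ _ (fun w hw => ?_)
    refine le_trans (card_le_card ?_) (hcon w (by simpa using hw))
    intro z hz
    simp only [bipartiteBelow, mem_filter] at hz
    simp [mem_nb, hz, hz.2.symm]
  have h3 : (Wᶜ).card * a ≤ a * Fintype.card V := by
    rw [mul_comm]; exact Nat.mul_le_mul_left _ (card_le_univ _)
  omega

theorem clique_in_class {G : SimpleGraph V} {q a e b dm M r : ℕ} {Ws : Finset V} {cl : V → V}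
    (hA : ∀ S : Finset V, a < S.card → ∃ T ⊆ S, G.IsNClique q T)
    (hL : Linked G q Ws cl) (hae : a + M < e)
    (hF3 : ∀ x, b ≤ (univ.filter (fun y => e ≤ (nb G x ∩ nb G y).card)).card)
    (hF2 : ∀ E : Finset V, r + 1 ≤ E.card → ∃ x ∈ E, ∃ y ∈ E, x ≠ y ∧ e ≤ (nb G x ∩ nb G y).card)
    (hr : r ≤ q) (hdeg : ∀ x, dm ≤ (nb G x).card)
    (hnum : a * Fintype.card V < (b - M) * (dm - M))
    (x : V) (hx : x ∉ Ws) (W : Finset V) (hW : Ws ⊆ W) (hWM : W.card ≤ M) :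
    ∃ Q : Finset V, G.IsNClique (q+1) Q ∧ Q ⊆ cls cl W (cl x) := by
  have hbig := class_large hA hL (lt_of_le_of_lt (by have := card_le_card hW; omega) hae) hF3 x hx W hW
  obtain ⟨w, hwW, hw⟩ := exists_nbr a dm M hdeg (cls cl W (cl x)) W hWM
    (lt_of_lt_of_le hnum (Nat.mul_le_mul_right _ (by omega)))
  obtain ⟨P, hP, hPc⟩ := hA _ hw
  rw [subset_inter_iff] at hP
  have hQ := insert_clique hPc hP.1
  obtain ⟨y, hy, z, hz, hyz, hcom⟩ := hF2 (insert w P) (by rw [hQ.card_eq]; omega)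
  have hadj : G.Adj y z := hQ.isClique (by simpa using hy) (by simpa using hz) hyz
  have hout : ∀ t ∈ insert w P, t ∉ W := by
    intro t ht
    rcases mem_insert.1 ht with rfl | ht
    · exact hwW
    · exact (mem_cls.1 (hP.2 ht)).1
  obtain ⟨S, s1, s2, s3⟩ := avoid_clique hA (nb G y ∩ nb G z) W (by omega)
  rw [subset_inter_iff] at s1
  have s2' : Disjoint S Ws := disjoint_of_subset_right hW s2
  have hcl : cl y = cl z := hL y (fun h => hout y hy (hW h)) z (fun h => hout z hz (hW h)) S
    s3.card_eq.le s2' (link_CB s3 s1.1 s1.2)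
  have hycl : cl y = cl x := by
    rcases mem_insert.1 hy with rfl | hy'
    · rcases mem_insert.1 hz with rfl | hz'
      · exact absurd rfl hyz
      · rw [hcl]; exact (mem_cls.1 (hP.2 hz')).2
    · exact (mem_cls.1 (hP.2 hy')).2
  refine ⟨insert y S, insert_clique s3 s1.1, ?_⟩
  intro t ht
  rcases mem_insert.1 ht with h | ht'
  · rw [h]; exact mem_cls.2 ⟨hout _ hy, hycl⟩
  · clear ht
    rename' ht' => ht
    have htW : t ∉ W := disjoint_left.1 s2 ht
    refine mem_cls.2 ⟨htW, ?_⟩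
    have hyS : y ∉ S := notMem_nb s1.1
    have hzS : z ∉ S := notMem_nb s1.2
    -- S' = insert y (S.erase t)
    have hy' : y ∉ S.erase t := fun h => hyS (mem_of_mem_erase h)
    have e1 : insert t (insert y (S.erase t)) = insert y S := by
      rw [insert_comm, insert_erase ht]
    have hse : G.IsNClique (q-1) (S.erase t) := s3.erase_of_mem ht
    have hq : q - 1 + 1 = q := by
      have := s3.card_eq; have := card_pos.2 ⟨t, ht⟩; omega
    have hS'c : G.IsNClique q (insert y (S.erase t)) := by
      rw [← hq]; exact insert_clique hse ((erase_subset _ _).trans s1.1)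
    have := hL t (fun h => htW (hW h)) z (fun h => hout z hz (hW h)) (insert y (S.erase t))
      hS'c.card_eq.le (by
        rw [disjoint_insert_left]
        exact ⟨fun h => hout y hy (hW h), disjoint_of_subset_left (erase_subset _ _) s2'⟩)
      (link_CB hS'c (by
        intro u hu
        rcases mem_insert.1 hu with rfl | hu
        · exact mem_nb.2 (mem_nb.1 (s1.1 ht)).symm
        · exact mem_nb.2 (s3.isClique (by simpa using ht) (by simpa using mem_of_mem_erase hu)
            (ne_of_mem_erase hu).symm)) (by
        intro u hu
        rcases mem_insert.1 hu with rfl | hu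
        · exact mem_nb.2 hadj.symm
        · exact s1.2 (mem_of_mem_erase hu)))
    rw [this, ← hcl, hycl]

def Absb (G : SimpleGraph V) (k : ℕ) (A I : Finset V) : Prop :=
  Disjoint A I ∧ Til G k A ∧ Til G k (A ∪ I)

theorem absorber {G : SimpleGraph V} {q a e b dm M M' c r : ℕ} {Ws : Finset V} {cl : V → V}
    (hA : ∀ S : Finset V, a < S.card → ∃ T ⊆ S, G.IsNClique q T)
    (hL : Linked G q Ws cl) (hae : a + M < e)
    (hF3 : ∀ x, b ≤ (univ.filter (fun y => e ≤ (nb G x ∩ nb G y).card)).card)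
    (hF2 : ∀ E : Finset V, r + 1 ≤ E.card → ∃ x ∈ E, ∃ y ∈ E, x ≠ y ∧ e ≤ (nb G x ∩ nb G y).card)
    (hr : r ≤ q) (hdeg : ∀ x, dm ≤ (nb G x).card)
    (hnum : a * Fintype.card V < (b - M) * (dm - M))
    (hR : ∀ x ∉ Ws, ∀ y ∉ Ws, x ≠ y → cl x = cl y → R G (q+1) c M x y)
    (hM : M' + Ws.card + (q + 1) * (c + 2) ≤ M)
    (I : Finset V) (hI : I.card = q + 1) (i : V) (hIc : I ⊆ cls cl Ws i)
    (W : Finset V) (hW : W.card ≤ M') :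
    ∃ A : Finset V, A.card ≤ (q+1) * (c+1) ∧ Disjoint A W ∧ Absb G (q+1) A I := by
  classical
  obtain ⟨x, hx⟩ : I.Nonempty := card_pos.1 (by omega)
  have hx' := mem_cls.1 (hIc hx)
  have hcard : (W ∪ I ∪ Ws).card ≤ M' + (q + 1) + Ws.card := by
    have := card_union_le (W ∪ I) Ws; have := card_union_le W I; omega
  obtain ⟨Q, hQ, hQc⟩ := clique_in_class hA hL hae hF3 hF2 hr hdeg hnum x hx'.1 (W ∪ I ∪ Ws)
    subset_union_right (by nlinarith)
  rw [hx'.2] at hQc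
  obtain ⟨f, hf⟩ : ∃ f : V → V, Set.BijOn f I Q := by
    have : I.card = Q.card := by rw [hI, hQ.card_eq]
    have hne : Nonempty V := ⟨x⟩
    exact (I.finite_toSet).exists_bijOn_of_encard_eq (by
      rw [Set.encard_coe_eq_coe_finsetCard, Set.encard_coe_eq_coe_finsetCard, this])
  have hQout : ∀ t ∈ Q, t ∉ W ∧ t ∉ I ∧ t ∉ Ws ∧ cl t = i := by
    intro t ht; have := mem_cls.1 (hQc ht); simp only [mem_union, not_or] at this; tauto
  obtain ⟨S, hS, hSd⟩ := greedy (fun u S => CB G (q+1) S u (f u)) c M (W ∪ I ∪ Q) I (by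
      have := card_union_le (W ∪ I) Q; have := card_union_le W I
      have := hQ.card_eq
      rw [hI] at *
      nlinarith) (by
      intro u hu W' hW'
      have hfu : f u ∈ Q := hf.mapsTo (by simpa using hu)
      have h2 := mem_cls.1 (hIc hu)
      exact hR u h2.1 (f u) (hQout _ hfu).2.2.1 (by
        intro h; exact (hQout _ hfu).2.1 (h ▸ hu)) (by rw [h2.2, (hQout _ hfu).2.2.2]) W' hW')
  simp only [disjoint_union_right] at hS
  have hfI : I.image f = Q := by
    apply Finset.coe_injective; rw [coe_image]; exact hf.image_eq
  have hUd : Disjoint Q (I.biUnion S) := by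
    rw [disjoint_biUnion_right]; intro u hu; exact (hS u hu).2.1.2.symm
  have hQI : Disjoint Q I := disjoint_left.2 (fun t ht => (hQout t ht).2.1)
  have hUI : Disjoint (I.biUnion S) I := by
    rw [disjoint_biUnion_left]; intro u hu; exact (hS u hu).2.1.1.2
  refine ⟨Q ∪ I.biUnion S, ?_, ?_, ?_, ?_, ?_⟩
  · have := card_union_le Q (I.biUnion S)
    have := card_biUnion_le_card_mul I S c (fun u hu => (hS u hu).1)
    rw [hQ.card_eq] at *
    rw [hI] at *
    nlinarith
  · rw [disjoint_union_left, disjoint_biUnion_left]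
    exact ⟨disjoint_left.2 (fun t ht => (hQout t ht).1), fun u hu => (hS u hu).2.1.1.1⟩
  · rw [disjoint_union_left]; exact ⟨hQI, hUI⟩
  · have : Q ∪ I.biUnion S = I.biUnion (fun u => insert (f u) (S u)) := by
      rw [← hfI]; ext t
      simp only [mem_union, mem_image, mem_biUnion, mem_insert]
      constructor
      · rintro (⟨u, hu, rfl⟩ | ⟨u, hu, h⟩)
        · exact ⟨u, hu, Or.inl rfl⟩
        · exact ⟨u, hu, Or.inr h⟩
      · rintro ⟨u, hu, rfl | h⟩
        · exact Or.inl ⟨u, hu, rfl⟩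
        · exact Or.inr ⟨u, hu, h⟩
    rw [this]
    refine til_biUnion _ _ (fun u hu => (hS u hu).2.2.2.2.2) ?_
    intro u hu v hv huv
    have hfu : f u ∈ Q := hf.mapsTo (by simpa using hu)
    have hfv : f v ∈ Q := hf.mapsTo (by simpa using hv)
    rw [disjoint_insert_left, disjoint_insert_right, mem_insert, not_or]
    refine ⟨⟨fun h => huv (hf.injOn (by simpa using hu) (by simpa using hv) h), ?_⟩, ?_, hSd u hu v hv huv⟩
    · exact disjoint_right.1 (hS v hv).2.1.2 hfu
    · exact disjoint_right.1 (hS u hu).2.1.2 hfv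
  · have : (Q ∪ I.biUnion S) ∪ I = Q ∪ I.biUnion (fun u => insert u (S u)) := by
      ext t
      simp only [mem_union, mem_biUnion, mem_insert]
      constructor
      · rintro ((h | ⟨u, hu, h⟩) | h)
        · exact Or.inl h
        · exact Or.inr ⟨u, hu, Or.inr h⟩
        · exact Or.inr ⟨t, h, Or.inl rfl⟩
      · rintro (h | ⟨u, hu, rfl | h⟩)
        · exact Or.inl (Or.inl h)
        · exact Or.inr hu
        · exact Or.inl (Or.inr ⟨u, hu, h⟩)
    rw [this]
    refine til_union (til_clique hQ) (til_biUnion _ _ (fun u hu => (hS u hu).2.2.2.2.1) ?_) ?_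
    · intro u hu v hv huv
      rw [disjoint_insert_left, disjoint_insert_right, mem_insert, not_or]
      refine ⟨⟨huv, ?_⟩, ?_, hSd u hu v hv huv⟩
      · exact disjoint_right.1 (hS v hv).2.1.1.2 hu
      · exact disjoint_right.1 (hS u hu).2.1.1.2 hv
    · rw [disjoint_biUnion_right]; intro u hu
      rw [disjoint_insert_right]
      exact ⟨fun h => (hQout u h).2.1 hu, (hS u hu).2.1.2.symm⟩

end QT

open Finset
namespace QT
set_option linter.unusedSectionVars false
variable {V : Type*} [Fintype V] [DecidableEq V]

def St (k : ℕ) (K : Finset (Finset V)) (F : ℕ → Finset V) (Z : Finset V) : Prop :=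
  ∃ U ⊆ K, ∃ R : Finset V, R.card < k ∧ R ⊆ F R.card ∧
    (∀ I ∈ U, ∀ J ∈ U, I ≠ J → Disjoint I J) ∧ (∀ I ∈ U, Disjoint I R) ∧ U.biUnion id ∪ R = Z

theorem St.add {k : ℕ} {K K' : Finset (Finset V)} {F F' : ℕ → Finset V} {Z : Finset V} {v : V}
    (hs : St k K F Z) (hv : v ∉ Z) (hF : ∀ s, insert v (F s) ⊆ F' (s+1)) (hK : K ⊆ K')
    (hK' : powersetCard k (F' k) ⊆ K') (hF0 : 0 < k) : St k K' F' (insert v Z) := by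
  obtain ⟨U, hU, R, h1, h2, h3, h4, h5⟩ := hs
  have hvR : v ∉ R := fun h => hv (by rw [← h5]; simp [h])
  have hvU : ∀ I ∈ U, v ∉ I := fun I hI h => hv (by
    rw [← h5, mem_union, mem_biUnion]; exact Or.inl ⟨I, hI, h⟩)
  have hcard : (insert v R).card = R.card + 1 := card_insert_of_notMem hvR
  have hsub : insert v R ⊆ F' (R.card + 1) := (insert_subset_insert _ h2).trans (hF _)
  have hd : ∀ I ∈ U, Disjoint I (insert v R) := fun I hI => by
    rw [disjoint_insert_right]; exact ⟨hvU I hI, h4 I hI⟩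
  by_cases hk : R.card + 1 = k
  · refine ⟨insert (insert v R) U, ?_, ∅, by simpa using hF0, by simp, ?_, by simp, ?_⟩
    · rw [insert_subset_iff]
      refine ⟨hK' (mem_powersetCard.2 ⟨?_, by omega⟩), hU.trans hK⟩
      rw [← hk]; exact hsub
    · intro I hI J hJ hIJ
      rcases mem_insert.1 hI with rfl | hI' <;> rcases mem_insert.1 hJ with rfl | hJ'
      · exact absurd rfl hIJ
      · exact (hd J hJ').symm
      · exact hd I hI'
      · exact h3 I hI' J hJ' hIJ
    · rw [← h5, biUnion_insert]
      ext t; simp only [mem_union, mem_insert, id, notMem_empty]; tauto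
  · refine ⟨U, hU.trans hK, insert v R, by omega, by rw [hcard]; exact hsub, h3, hd, ?_⟩
    rw [← h5]; ext t; simp only [mem_union, mem_insert]; tauto

theorem window (k : ℕ) (hk : 0 < k) (b : V → V) (X : Finset V) (hinj : Set.InjOn b X)
    (hdis : ∀ x ∈ X, ∀ y ∈ X, b x ≠ y) :
    ∃ K : Finset (Finset V), K.card ≤ 4 ^ k * X.card ∧
      (∀ I ∈ K, I.card = k ∧ I ⊆ X ∪ X.image b) ∧ ∃ F : ℕ → Finset V, Monotone F ∧
      (∀ s, (F s).card ≤ 2 * s) ∧ (∀ s, F s ⊆ X ∪ X.image b) ∧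
      ∀ X' ⊆ X, St k K F (X' ∪ X.image b) := by
  induction X using Finset.induction_on with
  | empty =>
    refine ⟨∅, by simp, by simp, fun _ => ∅, monotone_const, by simp, by simp, ?_⟩
    intro X' hX'
    rw [subset_empty] at hX'
    subst hX'
    exact ⟨∅, by simp, ∅, by simpa using hk, by simp⟩
  | insert x X hx ih =>
    obtain ⟨K, hK1, hK2, F, hF1, hF2, hF3, hSt⟩ := ih (hinj.mono (by simp))
      (fun y hy z hz => hdis y (by simp [hy]) z (by simp [hz]))
    let F' : ℕ → Finset V := fun s => match s with
      | 0 => ∅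
      | s + 1 => F s ∪ {x, b x}
    have F'0 : F' 0 = ∅ := rfl
    have F's : ∀ s, F' (s+1) = F s ∪ {x, b x} := fun s => rfl
    have hF'1 : Monotone F' := by
      refine monotone_nat_of_le_succ (fun s => ?_)
      cases s with
      | zero => simp [F'0]
      | succ s => rw [F's, F's]; exact union_subset_union (hF1 (Nat.le_succ s)) subset_rfl
    have hF'2 : ∀ s, (F' s).card ≤ 2 * s := by
      intro s
      cases s with
      | zero => simp [F'0]
      | succ s =>
        rw [F's]
        have := card_union_le (F s) {x, b x}
        have := card_le_two (a := x) (b := b x)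
        have := hF2 s
        omega
    have hF'3 : ∀ s, F' s ⊆ insert x X ∪ (insert x X).image b := by
      intro s
      cases s with
      | zero => simp [F'0]
      | succ s =>
        rw [F's]
        intro t ht
        have := @hF3 s t
        simp only [mem_union, mem_insert, mem_singleton, image_insert] at *
        tauto
    refine ⟨K ∪ powersetCard k (F' k), ?_, ?_, F', hF'1, hF'2, hF'3, ?_⟩
    · have h1 := card_union_le K (powersetCard k (F' k))
      have h2 : (powersetCard k (F' k)).card ≤ 4 ^ k := by
        rw [card_powersetCard]
        calc ((F' k).card).choose k ≤ 2 ^ ((F' k).card) := Nat.choose_le_two_pow _ _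
          _ ≤ 2 ^ (2 * k) := Nat.pow_le_pow_right (by norm_num) (hF'2 k)
          _ = 4 ^ k := by rw [pow_mul]; norm_num
      rw [card_insert_of_notMem hx, mul_add]
      omega
    · intro I hI
      rcases mem_union.1 hI with h | h
      · refine ⟨(hK2 I h).1, (hK2 I h).2.trans ?_⟩
        exact union_subset_union (subset_insert _ _) (image_subset_image (subset_insert _ _))
      · rw [mem_powersetCard] at h
        exact ⟨h.2, h.1.trans (hF'3 k)⟩
    · intro X' hX'
      have hbx : b x ∉ X.image b := by
        intro h
        obtain ⟨y, hy, hxy⟩ := mem_image.1 h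
        have := hinj (by simp [hy]) (by simp) hxy
        exact hx (this ▸ hy)
      have hbx' : b x ∉ X'.erase x := by
        intro h
        exact hdis x (by simp) (b x) (hX' (mem_of_mem_erase h)) rfl
      have hsub : X'.erase x ⊆ X := by
        intro t ht
        have := hX' (mem_of_mem_erase ht)
        rcases mem_insert.1 this with h | h
        · exact absurd h (ne_of_mem_erase ht)
        · exact h
      have s1 := (hSt (X'.erase x) hsub).add (v := b x) (F' := F') (K' := K ∪ powersetCard k (F' k))
        (by simp only [mem_union, not_or]; exact ⟨hbx', hbx⟩)
        (by intro s; rw [F's]; intro t; simp only [mem_insert, mem_union, mem_singleton]; tauto)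
        subset_union_left subset_union_right hk
      by_cases hxX : x ∈ X'
      · have s2 := s1.add (v := x) (F' := F') (K' := K ∪ powersetCard k (F' k))
          (by
            simp only [mem_insert, mem_union, not_or, mem_image, not_exists]
            refine ⟨fun h => hdis x (by simp) x (by simp) h.symm, by simp, ?_⟩
            rintro y ⟨hy, h⟩
            exact hdis y (by simp [hy]) x (by simp) h)
          (by
            intro s
            rw [insert_subset_iff]
            refine ⟨?_, hF'1 (Nat.le_succ s)⟩
            rw [F's]; simp)
          subset_rfl subset_union_right hk
        convert s2 using 1
        rw [image_insert]
        ext t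
        simp only [mem_union, mem_insert, mem_erase]
        by_cases ht : t = x
        · simp [ht, hxX]
        · simp [ht]; tauto
      · convert s1 using 1
        rw [image_insert, erase_eq_of_notMem hxX]
        ext t
        simp only [mem_union, mem_insert]
        tauto

/-- multiplicative weights: a reservoir -/
theorem reservoir_aux (G : SimpleGraph V) (δ : ℝ) (hδ : 0 ≤ δ) (W : Finset V) (N : ℕ)
    (hdeg : ∀ x, δ * Fintype.card V + N + W.card ≤ (nb G x).card) (h0 : 0 < Fintype.card V) :
    ∀ j ≤ N, ∃ X : Finset V, X.card = j ∧ Disjoint X W ∧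
      ∑ u : V, (1/2 : ℝ) ^ ((nb G u ∩ X).card) ≤ Fintype.card V * (1 - δ/2) ^ j := by
  classical
  intro j
  induction j with
  | zero => intro _; exact ⟨∅, by simp⟩
  | succ j ih =>
    intro hj
    obtain ⟨X, hX, hXW, hs⟩ := ih (by omega)
    set w : V → ℝ := fun u => (1/2 : ℝ) ^ ((nb G u ∩ X).card) with hw
    have hwpos : ∀ u, 0 ≤ w u := fun u => by positivity
    -- choose v
    have hex : ∃ v, v ∉ X ∪ W ∧ δ * ∑ u, w u ≤ ∑ u ∈ nb G v, w u := by
      by_contra hcon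
      push Not at hcon
      have e1 : ∑ v ∈ (X ∪ W)ᶜ, ∑ u ∈ nb G v, w u = ∑ u, w u * ((nb G u \ (X ∪ W)).card) := by
        have : ∀ v, ∑ u ∈ nb G v, w u = ∑ u, if G.Adj v u then w u else 0 := by
          intro v
          rw [← sum_filter]
          congr 1
        simp_rw [this]
        rw [sum_comm]
        refine sum_congr rfl (fun u _ => ?_)
        rw [← sum_filter, sum_const, nsmul_eq_mul, mul_comm]
        congr 3
        ext t; simp [mem_nb, G.adj_comm]; tauto
      have e2 : ∀ u, δ * Fintype.card V ≤ ((nb G u \ (X ∪ W)).card : ℝ) := by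
        intro u
        have h1 := le_card_sdiff (X ∪ W) (nb G u)
        have h2 := card_union_le X W
        have h3 : ((nb G u).card : ℝ) ≤ (nb G u \ (X ∪ W)).card + N + W.card := by
          exact_mod_cast (by omega : (nb G u).card ≤ (nb G u \ (X ∪ W)).card + N + W.card)
        have := hdeg u
        linarith
      have e3 : δ * Fintype.card V * ∑ u, w u ≤ ∑ v ∈ (X ∪ W)ᶜ, ∑ u ∈ nb G v, w u := by
        rw [e1, mul_sum]
        refine sum_le_sum (fun u _ => ?_)
        rw [mul_comm]
        exact mul_le_mul_of_nonneg_left (e2 u) (hwpos u)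
      have hSpos : 0 < ∑ u, w u := by
        obtain ⟨u0⟩ : Nonempty V := Fintype.card_pos_iff.1 h0
        exact sum_pos (fun u _ => by positivity) ⟨u0, mem_univ _⟩
      have hne : ((X ∪ W)ᶜ).Nonempty := by
        rw [← card_pos, card_compl]
        obtain ⟨u0⟩ : Nonempty V := Fintype.card_pos_iff.1 h0
        have h1 := hdeg u0
        have h2 : ((nb G u0).card : ℝ) ≤ Fintype.card V := by exact_mod_cast card_le_univ _
        have h3 : ((N + W.card : ℕ) : ℝ) ≤ Fintype.card V := by
          push_cast
          nlinarith [mul_nonneg hδ (Nat.cast_nonneg (α := ℝ) (Fintype.card V))]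
        have h4 : N + W.card ≤ Fintype.card V := by exact_mod_cast h3
        have := card_union_le X W
        omega
      have e4 : ∑ v ∈ (X ∪ W)ᶜ, ∑ u ∈ nb G v, w u < ∑ v ∈ (X ∪ W)ᶜ, δ * ∑ u, w u :=
        sum_lt_sum_of_nonempty hne (fun v hv => hcon v (by simpa using hv))
      rw [sum_const, nsmul_eq_mul] at e4
      have e5 : (((X ∪ W)ᶜ).card : ℝ) ≤ Fintype.card V := by exact_mod_cast card_le_univ _
      have e6 : (((X ∪ W)ᶜ).card : ℝ) * (δ * ∑ u, w u) ≤ Fintype.card V * (δ * ∑ u, w u) :=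
        mul_le_mul_of_nonneg_right e5 (mul_nonneg hδ hSpos.le)
      nlinarith
    obtain ⟨v, hv, hvs⟩ := hex
    simp only [mem_union, not_or] at hv
    refine ⟨insert v X, by rw [card_insert_of_notMem hv.1, hX], ?_, ?_⟩
    · rw [disjoint_insert_left]; exact ⟨hv.2, hXW⟩
    · have e1 : ∀ u, (1/2 : ℝ) ^ ((nb G u ∩ insert v X).card) =
          w u - (1/2) * (if G.Adj v u then w u else 0) := by
        intro u
        by_cases h : G.Adj v u
        · have : nb G u ∩ insert v X = insert v (nb G u ∩ X) := by
            rw [inter_insert_of_mem (mem_nb.2 h.symm)]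
          rw [this, card_insert_of_notMem (by simp [hv.1]), pow_succ, if_pos h]
          simp only [hw]; ring
        · rw [inter_insert_of_notMem (fun h' => h (mem_nb.1 h').symm), if_neg h]; simp [hw]
      simp_rw [e1]
      rw [sum_sub_distrib, ← mul_sum, ← sum_filter]
      have e2 : univ.filter (fun u => G.Adj v u) = nb G v := by ext t; simp [mem_nb]
      rw [e2]
      have hδ1 : δ ≤ 1 := by
        obtain ⟨u0⟩ : Nonempty V := Fintype.card_pos_iff.1 h0
        have h1 := hdeg u0
        have h2 : ((nb G u0).card : ℝ) ≤ Fintype.card V := by exact_mod_cast card_le_univ _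
        have h3 : (0:ℝ) < Fintype.card V := by exact_mod_cast h0
        have h4 : (0:ℝ) ≤ N := Nat.cast_nonneg _
        have h5 : (0:ℝ) ≤ W.card := Nat.cast_nonneg _
        by_contra h; push Not at h; nlinarith
      have : (∑ u, w u) - 1/2 * ∑ u ∈ nb G v, w u ≤ (1 - δ/2) * ∑ u, w u := by linarith
      refine this.trans ?_
      rw [pow_succ]
      calc (1 - δ/2) * ∑ u, w u ≤ (1 - δ/2) * (Fintype.card V * (1 - δ/2) ^ j) :=
            mul_le_mul_of_nonneg_left hs (by linarith)
        _ = _ := by ring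

theorem reservoir (G : SimpleGraph V) (δ : ℝ) (hδ : 0 ≤ δ) (hδ1 : δ ≤ 1) (W : Finset V) (N p : ℕ)
    (hdeg : ∀ x, δ * Fintype.card V + N + W.card ≤ (nb G x).card) (h0 : 0 < Fintype.card V)
    (hp : (1 - δ/2) ^ p ≤ 1/4) (hN : (Fintype.card V) ^ p < 2 ^ N) :
    ∃ X : Finset V, X.card = N ∧ Disjoint X W ∧ ∀ u, N ≤ p * (nb G u ∩ X).card := by
  obtain ⟨X, h1, h2, h3⟩ := reservoir_aux G δ hδ W N hdeg h0 N le_rfl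
  refine ⟨X, h1, h2, fun u => ?_⟩
  by_contra hcon
  push Not at hcon
  have h4 : (1/2 : ℝ) ^ ((nb G u ∩ X).card) ≤ Fintype.card V * (1 - δ/2) ^ N :=
    le_trans (single_le_sum (f := fun u => (1/2 : ℝ) ^ ((nb G u ∩ X).card))
      (fun i _ => by positivity) (mem_univ u)) h3
  have hb : (0:ℝ) ≤ 1 - δ/2 := by linarith
  have h5 : ((1/2 : ℝ) ^ ((nb G u ∩ X).card)) ^ p ≤ (Fintype.card V * (1 - δ/2) ^ N) ^ p :=
    pow_le_pow_left₀ (by positivity) h4 p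
  have h6 : ((Fintype.card V : ℝ) * (1 - δ/2) ^ N) ^ p ≤ (Fintype.card V : ℝ) ^ p * (1/4) ^ N := by
    rw [mul_pow, ← pow_mul, mul_comm N p, pow_mul]
    exact mul_le_mul_of_nonneg_left (pow_le_pow_left₀ (by positivity) hp N) (by positivity)
  have h7 : (1/2 : ℝ) ^ N ≤ ((1/2 : ℝ) ^ ((nb G u ∩ X).card)) ^ p := by
    rw [← pow_mul]
    exact pow_le_pow_of_le_one (by norm_num) (by norm_num) (by rw [mul_comm]; exact hcon.le)
  have h8 : ((Fintype.card V : ℝ)) ^ p < 2 ^ N := by exact_mod_cast hN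
  have h9 : (1/2 : ℝ) ^ N ≤ (Fintype.card V : ℝ) ^ p * (1/4) ^ N := h7.trans (h5.trans h6)
  have h10 : (Fintype.card V : ℝ) ^ p * (1/4) ^ N < 2 ^ N * (1/4) ^ N :=
    mul_lt_mul_of_pos_right h8 (by positivity)
  rw [← mul_pow] at h10
  norm_num at h10 h9
  linarith

end QT

open Finset
namespace QT
set_option linter.unusedSectionVars false
variable {V : Type*} [Fintype V] [DecidableEq V]

theorem bonf (G : SimpleGraph V) (e : ℝ) (he : 0 ≤ e) (E : Finset V)
    (h : ∀ x ∈ E, ∀ y ∈ E, x ≠ y → ((nb G x ∩ nb G y).card : ℝ) ≤ e) :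
    ∑ x ∈ E, ((nb G x).card : ℝ) ≤ (E.biUnion (nb G)).card + (E.card : ℝ) ^ 2 * e := by
  induction E using Finset.induction_on with
  | empty => simp
  | insert a E ha ih =>
    have ih' := ih (fun x hx y hy => h x (by simp [hx]) y (by simp [hy]))
    rw [sum_insert ha, biUnion_insert, card_insert_of_notMem ha]
    have h1 := card_union_add_card_inter (nb G a) (E.biUnion (nb G))
    have h2 : ((nb G a ∩ E.biUnion (nb G)).card : ℝ) ≤ E.card * e := by
      have h3 : nb G a ∩ E.biUnion (nb G) = E.biUnion (fun x => nb G a ∩ nb G x) := by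
        rw [inter_biUnion]
      rw [h3]
      calc ((E.biUnion (fun x => nb G a ∩ nb G x)).card : ℝ)
          ≤ ∑ x ∈ E, ((nb G a ∩ nb G x).card : ℝ) := by exact_mod_cast card_biUnion_le
        _ ≤ ∑ x ∈ E, e := sum_le_sum (fun x hx => h a (by simp) x (by simp [hx])
            (by rintro rfl; exact ha hx))
        _ = _ := by rw [sum_const, nsmul_eq_mul]
    have h1' : ((nb G a ∪ E.biUnion (nb G)).card : ℝ) + (nb G a ∩ E.biUnion (nb G)).card
      = (nb G a).card + (E.biUnion (nb G)).card := by exact_mod_cast h1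
    push_cast
    have : (0:ℝ) ≤ E.card * e := by positivity
    nlinarith

theorem F2 (G : SimpleGraph V) (η ξ : ℝ) (hξ : 0 ≤ ξ) (r : ℕ)
    (hr : 1 + ((r:ℝ) + 1) ^ 2 * ξ < (r + 1) * η)
    (h0 : 0 < Fintype.card V)
    (hdeg : ∀ x, η * Fintype.card V ≤ (nb G x).card) (E : Finset V) (hE : r + 1 ≤ E.card) :
    ∃ x ∈ E, ∃ y ∈ E, x ≠ y ∧ ξ * Fintype.card V < (nb G x ∩ nb G y).card := by
  obtain ⟨E', hE', hc⟩ := exists_subset_card_eq hE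
  by_contra hcon
  push Not at hcon
  have h1 := bonf G (ξ * Fintype.card V) (by positivity) E'
    (fun x hx y hy => hcon x (hE' hx) y (hE' hy))
  have h2 : ((r:ℝ) + 1) * (η * Fintype.card V) ≤ ∑ x ∈ E', ((nb G x).card : ℝ) := by
    have := card_nsmul_le_sum E' (fun x => ((nb G x).card : ℝ)) _ (fun x _ => hdeg x)
    rw [hc, nsmul_eq_mul] at this
    push_cast at this
    exact this
  have h3 : ((E'.biUnion (nb G)).card : ℝ) ≤ Fintype.card V := by exact_mod_cast card_le_univ _
  rw [hc] at h1
  push_cast at h1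
  have h4 : (0:ℝ) < Fintype.card V := by exact_mod_cast h0
  nlinarith

theorem F3 (G : SimpleGraph V) (η : ℝ) (e : ℕ) (hη : 0 ≤ η) 
    (hdeg : ∀ x, η * Fintype.card V ≤ (nb G x).card) (x : V) :
    η ^ 2 * (Fintype.card V : ℝ) ^ 2 ≤
      ((univ.filter (fun y => e ≤ (nb G x ∩ nb G y).card)).card : ℝ) * Fintype.card V
        + e * Fintype.card V := by
  classical
  have e1 : ∑ y : V, (nb G x ∩ nb G y).card = ∑ w ∈ nb G x, (nb G w).card := by
    have a1 : ∀ y, (nb G x ∩ nb G y).card = ∑ w ∈ nb G x, if G.Adj y w then 1 else 0 := by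
      intro y
      rw [← sum_filter, sum_const, smul_eq_mul, mul_one]
      congr 1; ext t; simp [mem_nb]
    simp_rw [a1]
    rw [sum_comm]
    refine sum_congr rfl (fun w _ => ?_)
    rw [← sum_filter, sum_const, smul_eq_mul, mul_one]
    congr 1; ext t; simp [mem_nb, G.adj_comm]
  have e2 : η ^ 2 * (Fintype.card V : ℝ) ^ 2 ≤ ∑ w ∈ nb G x, ((nb G w).card : ℝ) := by
    have := card_nsmul_le_sum (nb G x) (fun w => ((nb G w).card : ℝ)) _ (fun x _ => hdeg x)
    rw [nsmul_eq_mul] at this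
    refine le_trans ?_ this
    have h1 := hdeg x
    have h2 : 0 ≤ η * Fintype.card V := by positivity
    nlinarith
  have e3 : ∑ y : V, (nb G x ∩ nb G y).card ≤
      ∑ y : V, ((if e ≤ (nb G x ∩ nb G y).card then Fintype.card V else 0) + e) := by
    refine sum_le_sum (fun y _ => ?_)
    split_ifs with h
    · have := card_le_univ (nb G x ∩ nb G y); omega
    · omega
  rw [sum_add_distrib, ← sum_filter, sum_const, sum_const, smul_eq_mul, smul_eq_mul, e1,
    card_univ] at e3
  have e4 : ∑ w ∈ nb G x, ((nb G w).card : ℝ) ≤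
     ((univ.filter (fun y => e ≤ (nb G x ∩ nb G y).card)).card : ℝ) * Fintype.card V
        + Fintype.card V * e := by exact_mod_cast e3
  linarith

theorem max_tiling (G : SimpleGraph V) (q a : ℕ) 
    (hA : ∀ S : Finset V, a < S.card → ∃ T ⊆ S, G.IsNClique q T)
    (Z : Finset V) (dm : ℕ) (hdeg : ∀ x, dm + Z.card + a ≤ (nb G x).card) :
    ∃ U : Finset V, Disjoint U Z ∧ Til G (q+1) (univ \ (Z ∪ U)) ∧
      (q + 1) * (U.card * dm) ≤ Fintype.card V * (U.card + q * (a + q)) := by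
  classical
  -- maximal tiling
  let P : Finset (Finset V) → Prop := fun T => (∀ S ∈ T, G.IsNClique (q+1) S) ∧
    (∀ S ∈ T, ∀ S' ∈ T, S ≠ S' → Disjoint S S') ∧ ∀ S ∈ T, Disjoint S Z
  obtain ⟨T, hT, hmax⟩ := exists_max_image (univ.filter P) card ⟨∅, by simp [P]⟩
  simp only [mem_filter, mem_univ, true_and] at hT hmax
  obtain ⟨hT1, hT2, hT3⟩ := hT
  set C := T.biUnion id with hC
  have hCZ : Disjoint C Z := by rw [hC, disjoint_biUnion_left]; exact hT3
  set U := univ \ (Z ∪ C) with hU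
  have hUZ : Disjoint U Z := disjoint_left.2 (fun x hx hz => by simp [hU, hz] at hx)
  have hUC : Disjoint U C := disjoint_left.2 (fun x hx hz => by simp [hU, hz] at hx)
  have hSU : ∀ S ∈ T, Disjoint S U := fun S hS =>
    (disjoint_of_subset_right (subset_biUnion_of_mem id hS) hUC).symm
  refine ⟨U, hUZ, ⟨T, hT1, hT2, ?_⟩, ?_⟩
  · rw [← hC]; ext x
    simp only [hU, mem_sdiff, mem_union, mem_univ, true_and]
    have : x ∈ C → x ∉ Z := fun h => disjoint_left.1 hCZ h
    tauto
  -- degree inside U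
  have hUdeg : ∀ u, u ∈ U → (nb G u ∩ U).card ≤ a := by
    intro u hu
    by_contra hcon
    push Not at hcon
    obtain ⟨S, hS, hSc⟩ := hA _ hcon
    rw [subset_inter_iff] at hS
    have hcl := insert_clique hSc hS.1
    have hsub : insert u S ⊆ U := by rw [insert_subset_iff]; exact ⟨hu, hS.2⟩
    have hnot : insert u S ∉ T := fun h => by
      have := disjoint_left.1 (hSU _ h) (mem_insert_self u S); exact this hu
    have := hmax (insert (insert u S) T) ⟨?_, ?_, ?_⟩
    · rw [card_insert_of_notMem hnot] at this; omega
    · intro S' h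
      rcases mem_insert.1 h with rfl | h
      · exact hcl
      · exact hT1 _ h
    · intro I hI J hJ hIJ
      rcases mem_insert.1 hI with rfl | hI' <;> rcases mem_insert.1 hJ with rfl | hJ'
      · exact absurd rfl hIJ
      · exact (disjoint_of_subset_right hsub (hSU J hJ')).symm
      · exact disjoint_of_subset_right hsub (hSU I hI')
      · exact hT2 I hI' J hJ' hIJ
    · intro S' h
      rcases mem_insert.1 h with rfl | h
      · exact disjoint_of_subset_left hsub hUZ
      · exact hT3 _ h
  -- each tile has at most one rich vertex
  have htile : ∀ S ∈ T, ∀ x ∈ S, ∀ y ∈ S, x ≠ y → a + q < (nb G x ∩ U).card →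
      a + q < (nb G y ∩ U).card → False := by
    intro S hS x hx y hy hxy h1 h2
    obtain ⟨A, hA1, hAc⟩ := hA (nb G x ∩ U) (by omega)
    obtain ⟨B, hB1, hBd, hBc⟩ := avoid_clique hA (nb G y ∩ U) A (by rw [hAc.card_eq]; omega)
    rw [subset_inter_iff] at hA1 hB1
    have cA := insert_clique hAc hA1.1
    have cB := insert_clique hBc hB1.1
    have hxU : x ∉ U := disjoint_left.1 (hSU S hS) hx
    have hyU : y ∉ U := disjoint_left.1 (hSU S hS) hy
    have hSZ := hT3 S hS
    have dAB : Disjoint (insert x A) (insert y B) := by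
      rw [disjoint_insert_left, disjoint_insert_right, mem_insert, not_or]
      exact ⟨⟨hxy, fun h => hxU (hB1.2 h)⟩, fun h => hyU (hA1.2 h), hBd.symm⟩
    have hne : insert x A ≠ insert y B := by
      intro h
      rw [h, disjoint_self_iff_empty] at dAB
      exact (insert_ne_empty _ _) dAB
    have dgen : ∀ (z : V) (D : Finset V), z ∈ S → D ⊆ U → ∀ S' ∈ T.erase S,
        Disjoint (insert z D) S' := by
      intro z D hz hD S' hS'
      rw [mem_erase] at hS'
      rw [disjoint_insert_left]
      exact ⟨disjoint_left.1 (hT2 S hS S' hS'.2 (Ne.symm hS'.1)) hz,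
        (disjoint_of_subset_right hD (hSU S' hS'.2)).symm⟩
    have dA := dgen x A hx hA1.2
    have dB := dgen y B hy hB1.2
    have nA : insert x A ∉ T.erase S := fun h => by
      have := dA _ h; rw [disjoint_self_iff_empty] at this; exact (insert_ne_empty _ _) this
    have nB : insert y B ∉ T.erase S := fun h => by
      have := dB _ h; rw [disjoint_self_iff_empty] at this; exact (insert_ne_empty _ _) this
    have := hmax (insert (insert x A) (insert (insert y B) (T.erase S))) ⟨?_, ?_, ?_⟩
    · rw [card_insert_of_notMem (by rw [mem_insert, not_or]; exact ⟨hne, nA⟩),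
        card_insert_of_notMem nB, card_erase_of_mem hS] at this
      have := card_pos.2 ⟨S, hS⟩
      omega
    · intro S' h
      rw [mem_insert, mem_insert] at h
      rcases h with rfl | rfl | h
      · exact cA
      · exact cB
      · exact hT1 _ (mem_of_mem_erase h)
    · intro I hI J hJ hIJ
      rw [mem_insert, mem_insert] at hI hJ
      rcases hI with rfl | rfl | hI <;> rcases hJ with rfl | rfl | hJ
      · exact absurd rfl hIJ
      · exact dAB
      · exact dA J hJ
      · exact dAB.symm
      · exact absurd rfl hIJ
      · exact dB J hJ
      · exact (dA I hI).symm
      · exact (dB I hI).symm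
      · exact hT2 I (mem_of_mem_erase hI) J (mem_of_mem_erase hJ) hIJ
    · intro S' h
      rw [mem_insert, mem_insert] at h
      rcases h with rfl | rfl | h
      · rw [disjoint_insert_left]
        exact ⟨disjoint_left.1 hSZ hx, disjoint_of_subset_left hA1.2 hUZ⟩
      · rw [disjoint_insert_left]
        exact ⟨disjoint_left.1 hSZ hy, disjoint_of_subset_left hB1.2 hUZ⟩
      · exact hT3 _ (mem_of_mem_erase h)
  have hsum : ∀ S ∈ T, ∑ v ∈ S, (nb G v ∩ U).card ≤ U.card + q * (a + q) := by
    intro S hS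
    have hcard := (hT1 S hS).card_eq
    by_cases h : ∃ x ∈ S, a + q < (nb G x ∩ U).card
    · obtain ⟨x, hx, hxr⟩ := h
      rw [← add_sum_erase S _ hx]
      have h1 : (nb G x ∩ U).card ≤ U.card := card_le_card inter_subset_right
      have h2 : ∑ v ∈ S.erase x, (nb G v ∩ U).card ≤ (S.erase x).card • (a + q) := by
        refine sum_le_card_nsmul _ _ _ (fun v hv => ?_)
        by_contra hcon
        push Not at hcon
        exact htile S hS x hx v (mem_of_mem_erase hv) (ne_of_mem_erase hv).symm hxr hcon
      rw [card_erase_of_mem hx, hcard, smul_eq_mul] at h2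
      simp only [Nat.add_sub_cancel] at h2
      omega
    · push Not at h
      obtain ⟨x, hx⟩ : S.Nonempty := card_pos.1 (by omega)
      rw [← add_sum_erase S _ hx]
      have h1 : (nb G x ∩ U).card ≤ U.card := card_le_card inter_subset_right
      have h2 : ∑ v ∈ S.erase x, (nb G v ∩ U).card ≤ (S.erase x).card • (a + q) :=
        sum_le_card_nsmul _ _ _ (fun v hv => h v (mem_of_mem_erase hv))
      rw [card_erase_of_mem hx, hcard, smul_eq_mul] at h2
      simp only [Nat.add_sub_cancel] at h2
      omega
  have key := sum_card_bipartiteAbove_eq_sum_card_bipartiteBelow (s := U) (t := C) (fun x y => G.Adj x y)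
  have k1 : U.card * dm ≤ ∑ u ∈ U, (bipartiteAbove (fun x y => G.Adj x y) C u).card := by
    rw [← smul_eq_mul]
    refine card_nsmul_le_sum _ _ _ (fun u hu => ?_)
    have h1 : nb G u ⊆ bipartiteAbove (fun x y => G.Adj x y) C u ∪ (Z ∪ nb G u ∩ U) := by
      intro z hz
      have hz' := mem_nb.1 hz
      by_cases h1 : z ∈ Z
      · simp [h1]
      · by_cases h2 : z ∈ C
        · simp [bipartiteAbove, h2, hz']
        · simp [hU, h1, h2, hz]
    have h2 := card_le_card h1
    have h3 := card_union_le (bipartiteAbove (fun x y => G.Adj x y) C u) (Z ∪ nb G u ∩ U)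
    have h4 := card_union_le Z (nb G u ∩ U)
    have := hUdeg u hu
    have := hdeg u
    omega
  have k2 : ∑ w ∈ C, (bipartiteBelow (fun x y => G.Adj x y) U w).card ≤
      T.card * (U.card + q * (a + q)) := by
    have : ∀ w, (bipartiteBelow (fun x y => G.Adj x y) U w) = nb G w ∩ U := by
      intro w; ext t; simp [bipartiteBelow, mem_nb, G.adj_comm]; tauto
    simp_rw [this]
    rw [hC, sum_biUnion (by intro I hI J hJ hIJ; exact hT2 I hI J hJ hIJ), ← smul_eq_mul]
    exact sum_le_card_nsmul _ _ _ hsum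
  have k3 : (q + 1) * T.card ≤ Fintype.card V := by
    have : C.card = T.card * (q+1) := by
      rw [hC, card_biUnion (by intro I hI J hJ hIJ; exact hT2 I hI J hJ hIJ), ← smul_eq_mul]
      exact sum_const_nat (fun S hS => (hT1 S hS).card_eq)
    rw [mul_comm, ← this]; exact card_le_univ _
  calc (q + 1) * (U.card * dm) ≤ (q+1) * (T.card * (U.card + q * (a + q))) := by
        apply Nat.mul_le_mul_left; omega
    _ = ((q+1) * T.card) * (U.card + q * (a + q)) := by ring
    _ ≤ _ := Nat.mul_le_mul_right _ k3

end QT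

open Finset

namespace QT

set_option linter.unusedSectionVars false

variable {V : Type*} [Fintype V] [DecidableEq V]

theorem core {G : SimpleGraph V} {q a e b dm M M' c r N p L : ℕ} {Ws : Finset V} {cl : V → V}
    (D : Finset V) (hDr : D.card ≤ r) (hD : ∀ x ∉ Ws, cl x ∈ D)
    (hA : ∀ S : Finset V, a < S.card → ∃ T ⊆ S, G.IsNClique q T)
    (hL : Linked G q Ws cl) (hae : a + M < e)
    (hF3 : ∀ x, b ≤ (univ.filter (fun y => e ≤ (nb G x ∩ nb G y).card)).card)
    (hF2 : ∀ E : Finset V, r + 1 ≤ E.card → ∃ x ∈ E, ∃ y ∈ E, x ≠ y ∧ e ≤ (nb G x ∩ nb G y).card)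
    (hr : r ≤ q) (hdeg : ∀ x, dm ≤ (nb G x).card)
    (hnum : a * Fintype.card V < (b - M) * (dm - M))
    (hR : ∀ x ∉ Ws, ∀ y ∉ Ws, x ≠ y → cl x = cl y → R G (q+1) c M x y)
    (hM' : Ws.card + 2 * N + 4 ^ (q+1) * N * ((q+1) * (c+1)) ≤ M')
    (hM : M' + Ws.card + (q + 1) * (c + 2) ≤ M)
    (X : Finset V) (hXN : X.card = N) (hXW : Disjoint X Ws) (hX : ∀ u, N ≤ p * (nb G u ∩ X).card)
    (hmax : ∀ Z : Finset V, Z.card ≤ M → ∃ U : Finset V, Disjoint U Z ∧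
      Til G (q+1) (univ \ (Z ∪ U)) ∧ U.card ≤ L)
    (hcov : p * (a + q * (Ws.card + L)) < N) :
    ∃ B : Finset V, Til G (q+1) B ∧ (univ \ B).card ≤ r * q := by
  classical
  have hXW' : ∀ x ∈ X, x ∉ Ws := fun x hx => disjoint_left.1 hXW hx
  have hbM : M < b := by
    by_contra h
    rw [Nat.sub_eq_zero_of_le (by omega)] at hnum
    omega
  -- buffers
  obtain ⟨f, hf1, hf2⟩ := greedy (fun (x : V) (S : Finset V) => ∃ y, S = {y} ∧ y ∈ cls cl Ws (cl x))
    1 M' (Ws ∪ X) X (by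
      have := card_union_le Ws X
      have : 0 ≤ 4 ^ (q+1) * N * ((q+1) * (c+1)) := Nat.zero_le _
      omega) (by
      intro x hx W hW
      have h1 := class_large hA hL (by omega) hF3 x (hXW' x hx) (W ∪ Ws) subset_union_right
      have h2 := card_union_le W Ws
      have h3 : 0 < (cls cl (W ∪ Ws) (cl x)).card := by omega
      obtain ⟨y, hy⟩ := card_pos.1 h3
      rw [mem_cls, mem_union, not_or] at hy
      exact ⟨{y}, by simp, by simpa using hy.1.1, y, rfl, mem_cls.2 ⟨hy.1.2, hy.2⟩⟩)
  have hbx : ∀ x, ∃ y, x ∈ X → f x = {y} ∧ y ∈ cls cl Ws (cl x) := by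
    intro x
    by_cases hx : x ∈ X
    · obtain ⟨y, hy⟩ := (hf1 x hx).2.2
      exact ⟨y, fun _ => hy⟩
    · exact ⟨x, fun h => absurd h hx⟩
  choose bf hbf using hbx
  have bWs : ∀ x ∈ X, bf x ∉ Ws := fun x hx => (mem_cls.1 (hbf x hx).2).1
  have bcl : ∀ x ∈ X, cl (bf x) = cl x := fun x hx => (mem_cls.1 (hbf x hx).2).2
  have bX : ∀ x ∈ X, bf x ∉ X := fun x hx => by
    have := (hf1 x hx).2.1
    rw [(hbf x hx).1, disjoint_singleton_left, mem_union, not_or] at this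
    exact this.2
  have binj : Set.InjOn bf X := by
    intro x hx y hy hxy
    by_contra hne
    have := hf2 x hx y hy hne
    rw [(hbf x hx).1, (hbf y hy).1, hxy] at this
    simp at this
  -- windows
  have hwin : ∀ i, ∃ (K : Finset (Finset V)) (F : ℕ → Finset V),
      K.card ≤ 4 ^ (q+1) * (X.filter (fun x => cl x = i)).card ∧
      (∀ I ∈ K, I.card = q+1 ∧ I ⊆ X.filter (fun x => cl x = i) ∪ (X.filter (fun x => cl x = i)).image bf) ∧
      ∀ X' ⊆ X.filter (fun x => cl x = i), St (q+1) K F (X' ∪ (X.filter (fun x => cl x = i)).image bf) := by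
    intro i
    obtain ⟨K, h1, h2, F, -, -, -, h3⟩ := window (q+1) (by omega) bf (X.filter (fun x => cl x = i))
      (binj.mono (by intro x hx; exact (mem_filter.1 hx).1))
      (fun x hx y hy h => bX x (mem_filter.1 hx).1 (h ▸ (mem_filter.1 hy).1))
    exact ⟨K, F, h1, h2, h3⟩
  choose Kf Ff hK1 hK2 hSt using hwin
  have hKcl : ∀ i, ∀ I ∈ Kf i, I ⊆ cls cl Ws i := by
    intro i I hI z hz
    have := (hK2 i I hI).2 hz
    rw [mem_union, mem_filter, mem_image] at this
    rcases this with h | ⟨x, hx, rfl⟩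
    · exact mem_cls.2 ⟨hXW' z h.1, h.2⟩
    · rw [mem_filter] at hx
      exact mem_cls.2 ⟨bWs x hx.1, (bcl x hx.1).trans hx.2⟩
  have hKX : ∀ i, ∀ I ∈ Kf i, I ⊆ X ∪ X.image bf := by
    intro i I hI
    exact (hK2 i I hI).2.trans (union_subset_union (filter_subset _ _)
      (image_subset_image (filter_subset _ _)))
  set Kt := D.biUnion Kf with hKt
  have hKtc : Kt.card ≤ 4 ^ (q+1) * N := by
    calc Kt.card ≤ ∑ i ∈ D, (Kf i).card := card_biUnion_le
      _ ≤ ∑ i ∈ D, 4 ^ (q+1) * (X.filter (fun x => cl x = i)).card := sum_le_sum (fun i _ => hK1 i)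
      _ = 4 ^ (q+1) * N := by
        rw [← mul_sum, ← card_eq_sum_card_fiberwise (fun x hx => hD x (hXW' x hx)), hXN]
  set W0 := Ws ∪ X ∪ X.image bf with hW0
  have hW0c : W0.card ≤ Ws.card + 2 * N := by
    have h1 := card_union_le (Ws ∪ X) (X.image bf)
    rw [← hW0] at h1
    have h2 := card_union_le Ws X
    have h3 : (X.image bf).card ≤ X.card := card_image_le
    omega
  obtain ⟨A, hA1, hA2⟩ := greedy (fun (I : Finset V) (S : Finset V) => Absb G (q+1) S I)
    ((q+1) * (c+1)) M' W0 Kt (by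
      have := Nat.mul_le_mul_right ((q+1) * (c+1)) hKtc
      omega) (by
      intro I hI W hW
      rw [hKt, mem_biUnion] at hI
      obtain ⟨i, hi, hI⟩ := hI
      exact absorber hA hL hae hF3 hF2 hr hdeg hnum hR hM I (hK2 i I hI).1 i (hKcl i I hI) W hW)
  set Z := W0 ∪ Kt.biUnion A with hZ
  have hZc : Z.card ≤ M := by
    have h1 := card_union_le W0 (Kt.biUnion A)
    rw [← hZ] at h1
    have h2 : (Kt.biUnion A).card ≤ Kt.card * ((q+1) * (c+1)) :=
      card_biUnion_le_card_mul _ _ _ (fun I hI => (hA1 I hI).1)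
    have := Nat.mul_le_mul_right ((q+1) * (c+1)) hKtc
    omega
  obtain ⟨U, hUZ, hUT, hUL⟩ := hmax Z hZc
  have hUZ' : ∀ x ∈ U, x ∉ Z := fun x hx => disjoint_left.1 hUZ hx
  set U' := Ws ∪ U with hU'
  have hU'c : U'.card ≤ Ws.card + L := (card_union_le _ _).trans (by omega)
  obtain ⟨Q, hQ1, hQ2⟩ := greedy (fun (u : V) (S : Finset V) => S ⊆ nb G u ∩ X ∧ G.IsNClique q S)
    q (q * (Ws.card + L)) ∅ U' (by
      rw [card_empty, zero_add, mul_comm]; exact Nat.mul_le_mul_left _ hU'c) (by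
      intro u hu W hW
      have h1 : a + q * (Ws.card + L) < (nb G u ∩ X).card := by
        have := lt_of_lt_of_le hcov (hX u)
        exact lt_of_mul_lt_mul_left this (Nat.zero_le _)
      obtain ⟨S, hS1, hS2, hS3⟩ := avoid_clique hA (nb G u ∩ X) W (by omega)
      exact ⟨S, hS3.card_eq.le, hS2, hS1, hS3⟩)
  have hQX : ∀ u ∈ U', Q u ⊆ X := fun u hu => (hQ1 u hu).2.2.1.trans inter_subset_right
  have hQn : ∀ u ∈ U', Q u ⊆ nb G u := fun u hu => (hQ1 u hu).2.2.1.trans inter_subset_left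
  have hXZ : X ⊆ Z := fun x hx => by simp [hZ, hW0, hx]
  have hWZ : Ws ⊆ Z := fun x hx => by simp [hZ, hW0, hx]
  have hU'X : ∀ u ∈ U', u ∉ X := by
    intro u hu hx
    rcases mem_union.1 hu with h | h
    · exact hXW' u hx h
    · exact hUZ' u h (hXZ hx)
  set used := U'.biUnion Q with hused
  have hT2 : Til G (q+1) (U'.biUnion (fun u => insert u (Q u))) := by
    refine til_biUnion _ _ (fun u hu => til_clique (insert_clique (hQ1 u hu).2.2.2 (hQn u hu))) ?_
    intro u hu v hv huv
    rw [disjoint_insert_left, disjoint_insert_right, mem_insert, not_or]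
    exact ⟨⟨huv, fun h => hU'X u hu (hQX v hv h)⟩, fun h => hU'X v hv (hQX u hu h), hQ2 u hu v hv huv⟩
  have hst : ∀ i, St (q+1) (Kf i) (Ff i)
      ((X \ used).filter (fun x => cl x = i) ∪ (X.filter (fun x => cl x = i)).image bf) :=
    fun i => hSt i _ (filter_subset_filter _ sdiff_subset)
  choose Us hUs Rs hRs _ hUd hUR hUu using hst
  set Ut := D.biUnion Us with hUt
  have hUtd : ∀ I ∈ Ut, ∀ J ∈ Ut, I ≠ J → Disjoint I J := by
    intro I hI J hJ hIJ
    rw [hUt, mem_biUnion] at hI hJ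
    obtain ⟨i, hi, hI⟩ := hI
    obtain ⟨j, hj, hJ⟩ := hJ
    by_cases hij : i = j
    · subst hij; exact hUd i I hI J hJ hIJ
    · rw [disjoint_left]
      intro x hx hx'
      exact hij ((mem_cls.1 (hKcl i I (hUs i hI) hx)).2.symm.trans
        (mem_cls.1 (hKcl j J (hUs j hJ) hx')).2)
  have hKtX : ∀ I ∈ Kt, I ⊆ X ∪ X.image bf := by
    intro I hI
    rw [hKt, mem_biUnion] at hI
    obtain ⟨i, hi, hI⟩ := hI
    exact hKX i I hI
  have hUtX : ∀ I ∈ Ut, I ⊆ (X \ used) ∪ X.image bf := by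
    intro I hI x hx
    rw [hUt, mem_biUnion] at hI
    obtain ⟨i, hi, hI⟩ := hI
    have : x ∈ (Us i).biUnion id ∪ Rs i := mem_union_left _ (mem_biUnion.2 ⟨I, hI, hx⟩)
    rw [hUu i, mem_union, mem_filter, mem_image] at this
    rcases this with h | ⟨y, hy, rfl⟩
    · exact mem_union_left _ h.1
    · exact mem_union_right _ (mem_image_of_mem _ (mem_filter.1 hy).1)
  have hAI : ∀ I ∈ Kt, ∀ x ∈ A I, x ∉ W0 := fun I hI x hx => disjoint_left.1 (hA1 I hI).2.1 hx
  have hXbW : X ∪ X.image bf ⊆ W0 := by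
    intro x; simp only [hW0, mem_union]; tauto
  have hAJ : ∀ I ∈ Kt, ∀ J ∈ Kt, Disjoint (A I) J := fun I hI J hJ =>
    disjoint_of_subset_right ((hKtX J hJ).trans hXbW) (hA1 I hI).2.1
  set g : Finset V → Finset V := fun I => if I ∈ Ut then A I ∪ I else A I with hg
  have hgs : ∀ I, g I ⊆ A I ∪ (if I ∈ Ut then I else ∅) := by
    intro I; simp only [hg]; split_ifs <;> simp
  have hT3 : Til G (q+1) (Kt.biUnion g) := by
    refine til_biUnion _ _ ?_ ?_
    · intro I hI
      simp only [hg]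
      split_ifs
      · exact (hA1 I hI).2.2.2.2
      · exact (hA1 I hI).2.2.2.1
    · intro I hI J hJ hIJ
      refine disjoint_of_subset_left (hgs I) (disjoint_of_subset_right (hgs J) ?_)
      rw [disjoint_union_left, disjoint_union_right, disjoint_union_right]
      refine ⟨⟨hA2 I hI J hJ hIJ, ?_⟩, ?_, ?_⟩
      · split_ifs
        · exact hAJ I hI J hJ
        · simp
      · split_ifs
        · exact (hAJ J hJ I hI).symm
        · simp
      · split_ifs with h1 h2
        · exact hUtd I h1 J h2 hIJ
        all_goals simp
  -- description of the pieces
  have m2 : ∀ x, x ∈ U'.biUnion (fun u => insert u (Q u)) ↔ x ∈ U' ∨ x ∈ used := by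
    intro x
    simp only [mem_biUnion, mem_insert, hused]
    constructor
    · rintro ⟨u, hu, rfl | h⟩
      · exact Or.inl hu
      · exact Or.inr ⟨u, hu, h⟩
    · rintro (h | ⟨u, hu, h⟩)
      · exact ⟨x, h, Or.inl rfl⟩
      · exact ⟨u, hu, Or.inr h⟩
  have husedX : used ⊆ X := by
    intro x hx
    obtain ⟨u, hu, h⟩ := mem_biUnion.1 hx
    exact hQX u hu h
  have m3 : ∀ x, x ∈ Kt.biUnion g → x ∈ Kt.biUnion A ∨ x ∈ (X \ used) ∪ X.image bf := by
    intro x hx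
    obtain ⟨I, hI, h⟩ := mem_biUnion.1 hx
    have := hgs I h
    rw [mem_union] at this
    rcases this with h | h
    · exact Or.inl (mem_biUnion.2 ⟨I, hI, h⟩)
    · split_ifs at h with h1
      · exact Or.inr (hUtX I h1 h)
      · simp at h
  have hd23 : Disjoint (U'.biUnion (fun u => insert u (Q u))) (Kt.biUnion g) := by
    rw [disjoint_left]
    intro x h2 h3
    rw [m2] at h2
    have hx3 : x ∈ Z := by
      rcases m3 x h3 with h | h
      · exact mem_union_right _ h
      · exact mem_union_left _ (hXbW (union_subset_union sdiff_subset (Subset.refl _) h))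
    rcases m3 x h3 with h | h
    · obtain ⟨I, hI, h⟩ := mem_biUnion.1 h
      have hn := hAI I hI x h
      rcases h2 with h2 | h2
      · rcases mem_union.1 h2 with h2 | h2
        · exact hn (by simp [hW0, h2])
        · exact hUZ' x h2 hx3
      · exact hn (by simp [hW0, husedX h2])
    · rcases h2 with h2 | h2
      · rcases mem_union.1 h2 with h2 | h2
        · rcases mem_union.1 h with h | h
          · exact hXW' x (mem_sdiff.1 h).1 h2
          · obtain ⟨y, hy, rfl⟩ := mem_image.1 h
            exact bWs y hy h2
        · exact hUZ' x h2 hx3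
      · rcases mem_union.1 h with h | h
        · exact (mem_sdiff.1 h).2 h2
        · obtain ⟨y, hy, rfl⟩ := mem_image.1 h
          exact bX y hy (husedX h2)
  have hd1 : Disjoint (univ \ (Z ∪ U)) (U'.biUnion (fun u => insert u (Q u)) ∪ Kt.biUnion g) := by
    rw [disjoint_left]
    intro x h1 h2
    have h1 := (mem_sdiff.1 h1).2
    rw [mem_union, not_or] at h1
    rcases mem_union.1 h2 with h | h
    · rcases (m2 x).1 h with h | h
      · rcases mem_union.1 h with h | h
        · exact h1.1 (hWZ h)
        · exact h1.2 h
      · exact h1.1 (hXZ (husedX h))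
    · rcases m3 x h with h | h
      · exact h1.1 (mem_union_right _ h)
      · exact h1.1 (mem_union_left _ (hXbW (union_subset_union sdiff_subset (Subset.refl _) h)))
  refine ⟨_, til_union hUT (til_union hT2 hT3 hd23) hd1, ?_⟩
  refine (card_le_card (t := D.biUnion Rs) ?_).trans ?_
  · intro x hx
    rw [mem_sdiff, mem_union, mem_union, not_or, not_or, m2, not_or] at hx
    obtain ⟨-, hx1, ⟨hx2, hx3⟩, hx4⟩ := hx
    have hxU : x ∉ U := fun h => hx2 (mem_union_right _ h)
    have hxW : x ∉ Ws := fun h => hx2 (mem_union_left _ h)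
    have hxZ : x ∈ Z := by
      by_contra h
      exact hx1 (mem_sdiff.2 ⟨mem_univ _, by rw [mem_union, not_or]; exact ⟨h, hxU⟩⟩)
    have hxA : x ∉ Kt.biUnion A := by
      intro h
      obtain ⟨I, hI, h⟩ := mem_biUnion.1 h
      refine hx4 (mem_biUnion.2 ⟨I, hI, ?_⟩)
      simp only [hg]; split_ifs
      · exact mem_union_left _ h
      · exact h
    have hmem : x ∈ (X \ used).filter (fun y => cl y = cl x) ∪
        (X.filter (fun y => cl y = cl x)).image bf := by
      have : x ∈ X ∨ x ∈ X.image bf := by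
        simp only [hZ, hW0, mem_union] at hxZ
        tauto
      rcases this with h | h
      · exact mem_union_left _ (mem_filter.2 ⟨mem_sdiff.2 ⟨h, hx3⟩, rfl⟩)
      · obtain ⟨y, hy, rfl⟩ := mem_image.1 h
        exact mem_union_right _ (mem_image_of_mem _ (mem_filter.2 ⟨hy, (bcl y hy).symm⟩))
    rw [← hUu (cl x), mem_union] at hmem
    refine mem_biUnion.2 ⟨cl x, hD x hxW, ?_⟩
    rcases hmem with h | h
    · exfalso
      obtain ⟨I, hI, h⟩ := mem_biUnion.1 h
      have hIt : I ∈ Ut := mem_biUnion.2 ⟨cl x, hD x hxW, hI⟩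
      refine hx4 (mem_biUnion.2 ⟨I, mem_biUnion.2 ⟨cl x, hD x hxW, hUs _ hI⟩, ?_⟩)
      simp only [hg, if_pos hIt]
      exact mem_union_right _ h
    · exact h
  · refine (card_biUnion_le_card_mul _ _ q (fun i _ => by have := hRs i; omega)).trans
      (Nat.mul_le_mul_right _ hDr)

end QT

open Finset

namespace QT

set_option linter.unusedSectionVars false

variable {V : Type*} [Fintype V] [DecidableEq V]

set_option maxHeartbeats 1000000 in
theorem assembly {G : SimpleGraph V} {q r p a e b dm L mb C K K' : ℕ} (hr : r ≤ q)
    (hC : C = 4 ^ r * (q + 2)) (hK' : K' = p * (1 + q * (2 * r * r)) + 1)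
    (hK : K = 2 * (2 * r * r) + K' * (2 + 4 ^ (q+1) * ((q+1) * (C+1))) + (q+1) * (C+2) + (C + q + 5))
    (hA : ∀ S : Finset V, a < S.card → ∃ T ⊆ S, G.IsNClique q T)
    (hF3 : ∀ x, b ≤ (univ.filter (fun y => e ≤ (nb G x ∩ nb G y).card)).card)
    (hF2 : ∀ E : Finset V, r + 1 ≤ E.card → ∃ x ∈ E, ∃ y ∈ E, x ≠ y ∧ e ≤ (nb G x ∩ nb G y).card)
    (hdeg : ∀ x, dm ≤ (nb G x).card) (hmb : 1 ≤ mb)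
    (hae : a + mb * K ^ (r+1) < e)
    (hnum : a * Fintype.card V < (b - mb * K ^ (r+1)) * (dm - mb * K ^ (r+1)))
    (hmax : ∀ Z : Finset V, Z.card ≤ mb * K ^ (r+1) → ∃ U : Finset V, Disjoint U Z ∧
      Til G (q+1) (univ \ (Z ∪ U)) ∧ U.card ≤ L)
    (hres : ∀ (W : Finset V) (N : ℕ), W.card + N ≤ mb * K ^ (r+1) → mb ≤ N →
      ∃ X : Finset V, X.card = N ∧ Disjoint X W ∧ ∀ u, N ≤ p * (nb G u ∩ X).card)
    (haL : a + q * L ≤ mb) :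
    ∃ B : Finset V, Til G (q+1) B ∧ (univ \ B).card ≤ r * q := by
  have hK1 : 1 ≤ K := by rw [hK]; omega
  obtain ⟨t, ht, D, hDr, hD1, hD2⟩ := levels
    (fun t => R G (q+1) (4 ^ t * (q+2)) (mb * K ^ (r + 1 - t))) r (by
      intro E hE
      obtain ⟨x, hx, y, hy, hne, h⟩ := hF2 E hE.ge
      refine ⟨x, hx, y, hy, hne, ?_⟩
      have := R_base hA (mb * K ^ (r+1)) x y (by omega)
      exact R.mono this (by simp) (by simp))
  simp only [show r + 1 - (t+1) = r - t by omega, show r + 1 - t = (r - t) + 1 by omega] at hD1 hD2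
  set μ := mb * K ^ (r - t) with hμ
  have hμ1 : mb ≤ μ := Nat.le_mul_of_pos_right _ (by positivity)
  have hM : mb * K ^ (r - t + 1) = K * μ := by rw [hμ, pow_succ]; ring
  rw [hM] at hD2
  have hMle : K * μ ≤ mb * K ^ (r+1) := by
    rw [← hM]; exact Nat.mul_le_mul_left _ (Nat.pow_le_pow_right hK1 (by omega))
  set c := 4 ^ t * (q+2) with hc
  have hcC : c ≤ C := by
    rw [hc, hC]; exact Nat.mul_le_mul_right _ (Nat.pow_le_pow_right (by norm_num) ht)
  have hcq : q + 2 ≤ c := Nat.le_mul_of_pos_left _ (by positivity)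
  -- the constants
  set Q1 := 4 ^ (q+1) * ((q+1) * (C+1)) with hQ1
  set Q2 := (q+1) * (C+2) with hQ2
  have hKμ : K * μ = 2 * (2 * r * r * μ) + (2 * (K' * μ) + K' * μ * Q1) + Q2 * μ + (C + q + 5) * μ := by
    rw [hK]; ring
  have hQ2μ : Q2 ≤ Q2 * μ := Nat.le_mul_of_pos_right _ (by omega)
  have hCμ : C + q + 4 + μ ≤ (C + q + 5) * μ := by nlinarith
  obtain ⟨Ws, cl, hWs, hclD, hR, hL⟩ := structure_lemma G q r c (K * μ) (4 ^ (t+1) * (q+2)) μ D hDr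
    (by rw [pow_succ]; nlinarith) (by omega) hD1 hD2
  have hWs' : Ws.card ≤ 2 * r * r * μ := by
    have : r ≤ r * r * μ := by
      rcases Nat.eq_zero_or_pos r with h | h
      · simp [h]
      · calc r = r * 1 * 1 := by ring
          _ ≤ r * r * μ := by gcongr <;> omega
    have h2 : 2 * r * r * μ = 2 * (r * r * μ) := by ring
    omega
  obtain ⟨X, hX1, hX2, hX3⟩ := hres Ws (K' * μ) (by omega) (by
    have : 1 * μ ≤ K' * μ := Nat.mul_le_mul_right _ (by omega)
    omega)
  have q1 : 4 ^ (q+1) * (K' * μ) * ((q+1) * (c+1)) ≤ K' * μ * Q1 := by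
    rw [hQ1]
    calc 4 ^ (q+1) * (K' * μ) * ((q+1) * (c+1)) ≤ 4 ^ (q+1) * (K' * μ) * ((q+1) * (C+1)) := by gcongr
      _ = _ := by ring
  have q2 : (q+1) * (c+2) ≤ Q2 := by rw [hQ2]; gcongr
  refine core (M := K * μ) (M' := Ws.card + 2 * (K' * μ) + 4 ^ (q+1) * (K' * μ) * ((q+1) * (c+1)))
    (L := L) (p := p) D hDr hclD hA hL (by omega) hF3 hF2 hr hdeg ?_ hR le_rfl
    (by omega) X hX1 hX2 hX3 (fun Z hZ => hmax Z (hZ.trans hMle)) ?_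
  · refine lt_of_lt_of_le hnum (Nat.mul_le_mul (by omega) (by omega))
  · calc p * (a + q * (Ws.card + L)) = p * (a + q * L + q * Ws.card) := by ring
      _ ≤ p * (μ + q * (2 * r * r * μ)) := by gcongr; omega
      _ = p * (1 + q * (2 * r * r)) * μ := by ring
      _ < K' * μ := by
        rw [hK', add_mul, one_mul]; omega

end QT

open Finset

namespace QT

theorem large_n (γ c1 c2 : ℝ) (hγ : 0 < γ) (hc1 : 0 < c1) (p : ℕ) :
    ∃ N0 : ℕ, ∀ n : ℕ, N0 ≤ n → 1 ≤ n ∧ c2 ≤ c1 * n ∧ n ^ p < 2 ^ ⌊γ * n⌋₊ := by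
  have h1 : ∀ᶠ n : ℕ in Filter.atTop, 1 ≤ n := Filter.eventually_ge_atTop 1
  have h2 : ∀ᶠ n : ℕ in Filter.atTop, c2 / c1 ≤ (n : ℝ) :=
    tendsto_natCast_atTop_atTop.eventually_ge_atTop _
  have hl : 0 < Real.log 2 := Real.log_pos (by norm_num)
  have h3 : ∀ᶠ n : ℕ in Filter.atTop, ‖((n : ℝ)) ^ p‖ ≤ (1/4) * ‖Real.exp (γ * Real.log 2 * n)‖ :=
    tendsto_natCast_atTop_atTop.eventually
      ((isLittleO_pow_exp_pos_mul_atTop p (b := γ * Real.log 2) (by positivity)).def (by norm_num))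
  obtain ⟨N0, hN0⟩ := Filter.eventually_atTop.1 (h1.and (h2.and h3))
  refine ⟨N0, fun n hn => ?_⟩
  obtain ⟨a1, a2, a3⟩ := hN0 n hn
  refine ⟨a1, ?_, ?_⟩
  · rw [div_le_iff₀ hc1] at a2; linarith
  · rw [Real.norm_of_nonneg (by positivity), Real.norm_of_nonneg (by positivity)] at a3
    have hf := Nat.lt_floor_add_one (γ * n)
    have h4 : Real.exp (γ * Real.log 2 * n) ≤ 2 * 2 ^ ⌊γ * n⌋₊ := by
      have : (2:ℝ) * 2 ^ ⌊γ * n⌋₊ = Real.exp (Real.log 2 * (⌊γ * n⌋₊ + 1)) := by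
        rw [mul_comm (Real.log 2), add_mul, Real.exp_add, one_mul, Real.exp_log (by norm_num),
          Real.exp_nat_mul, Real.exp_log (by norm_num)]
        ring
      rw [this]
      apply Real.exp_le_exp.2
      nlinarith
    have h5 : (0:ℝ) < 2 ^ ⌊γ * n⌋₊ := by positivity
    have h6 : ((n : ℝ)) ^ p < 2 ^ ⌊γ * n⌋₊ := by linarith
    exact_mod_cast h6

set_option maxHeartbeats 2000000 in
theorem final_real (q : ℕ) (η : ℝ) (h1 : 1 / ((q:ℝ) + 1) < η) (h2 : η ≤ 1) :
    ∃ α : ℝ, 0 < α ∧ ∃ N0 : ℕ, ∀ n : ℕ, N0 ≤ n → ∀ G : SimpleGraph (Fin n),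
      (∀ x, η * n ≤ (nb G x).card) →
      (∀ S : Finset (Fin n), α * n < S.card → ∃ T ⊆ S, G.IsNClique q T) →
      ∃ B, Til G (q+1) B ∧ (univ \ B).card ≤ ⌊1 / η⌋₊ * q := by
  have hη : 0 < η := lt_trans (by positivity) h1
  set r := ⌊1 / η⌋₊ with hr
  have hr1 : 1 < ((r:ℝ) + 1) * η := by
    have := Nat.lt_floor_add_one (1 / η)
    rw [div_lt_iff₀ hη] at this
    exact this
  have hrq : r ≤ q := by
    have : r < q + 1 := by
      rw [hr, Nat.floor_lt (by positivity)]
      push_cast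
      rw [div_lt_comm₀ (by positivity) hη] at h1
      exact h1
    omega
  obtain ⟨ζ, hζ⟩ : ∃ ζ, ζ = η - 1 / ((q:ℝ)+1) := ⟨_, rfl⟩
  have hζ0 : 0 < ζ := by linarith
  have hζη : ((q:ℝ) + 1) * η = 1 + (q + 1) * ζ := by
    rw [hζ]; field_simp; ring
  obtain ⟨ξ, hξ0, hξ1, hξ2⟩ : ∃ ξ : ℝ, 0 < ξ ∧ 1 + ((r:ℝ) + 1) ^ 2 * ξ < (r + 1) * η ∧
      ξ ≤ η ^ 2 / 8 := by
    have hpos : 0 < (((r:ℝ) + 1) * η - 1) / (2 * ((r:ℝ)+1)^2) := by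
      apply div_pos <;> [linarith; positivity]
    refine ⟨min ((((r:ℝ) + 1) * η - 1) / (2 * ((r:ℝ)+1)^2)) (η ^ 2 / 8), lt_min hpos (by positivity),
      ?_, min_le_right _ _⟩
    have := mul_le_mul_of_nonneg_left
      (min_le_left ((((r:ℝ) + 1) * η - 1) / (2 * ((r:ℝ)+1)^2)) (η ^ 2 / 8))
      (by positivity : (0:ℝ) ≤ ((r:ℝ)+1)^2)
    have e : ((r:ℝ)+1)^2 * ((((r:ℝ) + 1) * η - 1) / (2 * ((r:ℝ)+1)^2)) = (((r:ℝ) + 1) * η - 1) / 2 := by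
      field_simp
    linarith
  obtain ⟨p, hp⟩ : ∃ p : ℕ, (1 - (η / 2) / 2) ^ p ≤ (1/4 : ℝ) := by
    obtain ⟨p, hp⟩ := exists_pow_lt_of_lt_one (by norm_num : (0:ℝ) < 1/4)
      (by linarith : 1 - (η/2)/2 < 1)
    exact ⟨p, hp.le⟩
  obtain ⟨C, hC⟩ : ∃ C, C = 4 ^ r * (q + 2) := ⟨_, rfl⟩
  obtain ⟨K', hK'⟩ : ∃ K', K' = p * (1 + q * (2 * r * r)) + 1 := ⟨_, rfl⟩
  obtain ⟨K, hK⟩ : ∃ K, K = 2 * (2 * r * r) + K' * (2 + 4 ^ (q+1) * ((q+1) * (C+1)))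
    + (q+1) * (C+2) + (C + q + 5) := ⟨_, rfl⟩
  have hK0 : 0 < K := by rw [hK]; omega
  obtain ⟨θ, hθ0, hθ1, hθ2, hθ3, hθ4⟩ : ∃ θ : ℝ, 0 < θ ∧ θ ≤ ξ / 2 ∧ θ ≤ η ^ 2 / 4 ∧ θ ≤ η / 2 ∧
      θ ≤ ζ / 4 := by
    refine ⟨min (min (ξ / 2) (η ^ 2 / 4)) (min (η / 2) (ζ / 4)), ?_, ?_, ?_, ?_, ?_⟩
    · simp only [lt_min_iff]; refine ⟨⟨?_, ?_⟩, ?_, ?_⟩ <;> positivity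
    · exact (min_le_left _ _).trans (min_le_left _ _)
    · exact (min_le_left _ _).trans (min_le_right _ _)
    · exact (min_le_right _ _).trans (min_le_left _ _)
    · exact (min_le_right _ _).trans (min_le_right _ _)
  have hKp : (0:ℝ) < (K:ℝ) ^ (r+1) := by positivity
  obtain ⟨γ, hγ⟩ : ∃ γ : ℝ, γ = θ / (K:ℝ) ^ (r+1) := ⟨_, rfl⟩
  have hγ0 : 0 < γ := by rw [hγ]; positivity
  have hγθ : γ * (K:ℝ) ^ (r+1) = θ := by rw [hγ]; field_simp
  obtain ⟨κ, hκ⟩ : ∃ κ : ℝ, κ = 1 + 2 * q / ζ := ⟨_, rfl⟩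
  have hκ0 : 0 < κ := by rw [hκ]; positivity
  obtain ⟨α, hα0, hα1, hα2, hα3, hα4⟩ : ∃ α : ℝ, 0 < α ∧ α ≤ ξ / 4 ∧ α ≤ ζ / 4 ∧ α ≤ η ^ 3 / 16 ∧
      α * κ ≤ γ / 2 := by
    refine ⟨min (min (ξ / 4) (ζ / 4)) (min (η ^ 3 / 16) (γ / 2 / κ)), ?_, ?_, ?_, ?_, ?_⟩
    · simp only [lt_min_iff]; refine ⟨⟨?_, ?_⟩, ?_, ?_⟩ <;> positivity
    · exact (min_le_left _ _).trans (min_le_left _ _)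
    · exact (min_le_left _ _).trans (min_le_right _ _)
    · exact (min_le_right _ _).trans (min_le_left _ _)
    · rw [← le_div_iff₀ hκ0]; exact (min_le_right _ _).trans (min_le_right _ _)
  refine ⟨α, hα0, ?_⟩
  obtain ⟨c1, hc1, hc1a, hc1b⟩ : ∃ c1 : ℝ, 0 < c1 ∧ c1 ≤ γ / 2 ∧ c1 ≤ η ^ 2 * (3/8) :=
    ⟨min (γ/2) (η ^ 2 * (3/8)), by simp only [lt_min_iff]; constructor <;> positivity,
      min_le_left _ _, min_le_right _ _⟩
  obtain ⟨N0, hN0⟩ := large_n γ c1 (2 * q ^ 2 / ζ + 1) hγ0 hc1 p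
  refine ⟨N0, fun n hn G hdeg hind => ?_⟩
  obtain ⟨hn1, hn2, hn3⟩ := hN0 n hn
  have hnpos : (0:ℝ) < n := by exact_mod_cast hn1
  have hq2 : 0 ≤ 2 * (q:ℝ) ^ 2 / ζ := by positivity
  have hn4 : 2 * (q:ℝ) ^ 2 / ζ + 1 ≤ γ / 2 * n := hn2.trans (by gcongr)
  have hn5 : 1 ≤ η ^ 2 * (3/8) * n := by
    have : c1 * n ≤ η ^ 2 * (3/8) * n := by gcongr
    linarith
  clear hn2
  obtain ⟨a, ha⟩ : ∃ a, a = ⌊α * n⌋₊ := ⟨_, rfl⟩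
  obtain ⟨mb, hmb⟩ : ∃ mb, mb = ⌊γ * n⌋₊ := ⟨_, rfl⟩
  rw [← hmb] at hn3
  obtain ⟨e, he⟩ : ∃ e, e = ⌈ξ * n⌉₊ := ⟨_, rfl⟩
  obtain ⟨b, hb⟩ : ∃ b, b = ⌈η ^ 2 / 2 * n⌉₊ := ⟨_, rfl⟩
  obtain ⟨dm, hdm⟩ : ∃ dm, dm = ⌈η * n⌉₊ := ⟨_, rfl⟩
  obtain ⟨L, hL⟩ : ∃ L, L = ⌊2 * ((a:ℝ) + q) / ζ⌋₊ := ⟨_, rfl⟩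
  have hA : ∀ S : Finset (Fin n), a < S.card → ∃ T ⊆ S, G.IsNClique q T := by
    intro S hS
    refine hind S ?_
    rw [ha] at hS
    exact (Nat.floor_lt (by positivity)).1 hS
  have ha' : (a:ℝ) ≤ α * n := by rw [ha]; exact Nat.floor_le (by positivity)
  have hmb1 : (mb:ℝ) ≤ γ * n := by rw [hmb]; exact Nat.floor_le (by positivity)
  have hmb2 : γ * n < mb + 1 := by rw [hmb]; exact Nat.lt_floor_add_one _
  have he1 : ξ * n ≤ e := by rw [he]; exact Nat.le_ceil _
  have he2 : (e:ℝ) < ξ * n + 1 := by rw [he]; exact Nat.ceil_lt_add_one (by positivity)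
  have hb1 : η ^ 2 / 2 * n ≤ b := by rw [hb]; exact Nat.le_ceil _
  have hdm1 : η * n ≤ dm := by rw [hdm]; exact Nat.le_ceil _
  have hdm2 : ∀ x, dm ≤ (nb G x).card := fun x => by rw [hdm]; exact Nat.ceil_le.2 (hdeg x)
  obtain ⟨M0, hM0⟩ : ∃ M0, M0 = mb * K ^ (r+1) := ⟨_, rfl⟩
  have hM0θ : (M0:ℝ) ≤ θ * n := by
    rw [hM0]; push_cast
    calc (mb:ℝ) * K ^ (r+1) ≤ γ * n * K ^ (r+1) := by gcongr
      _ = θ * n := by rw [← hγθ]; ring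
  have hmb0 : 1 ≤ mb := by
    have : (0:ℝ) < mb := by linarith
    exact_mod_cast this
  have hdegc : ∀ x, η * (Fintype.card (Fin n) : ℝ) ≤ (nb G x).card := by simpa using hdeg
  have hθn1 : θ * n ≤ ξ / 2 * n := by gcongr
  have hθn2 : θ * n ≤ η ^ 2 / 4 * n := by gcongr
  have hθn3 : θ * n ≤ η / 2 * n := by gcongr
  have hθn4 : θ * n ≤ ζ / 4 * n := by gcongr
  have hαn1 : α * n ≤ ξ / 4 * n := by gcongr
  have hαn2 : α * n ≤ ζ / 4 * n := by gcongr
  have hξn : ξ * n ≤ η ^ 2 / 8 * n := by gcongr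
  have hζη' : ζ < η := by rw [hζ]; linarith [show 0 < 1 / ((q:ℝ)+1) by positivity]
  have hζn : ζ * n < η * n := by gcongr
  have hξn0 : 0 < ξ * n := by positivity
  refine assembly (p := p) (a := a) (e := e) (b := b) (dm := dm) (L := L) (mb := mb) hrq hC hK' hK hA
    ?_ ?_ hdm2 hmb0 ?_ ?_ ?_ ?_ ?_
  · intro x
    have h := F3 G η e hη.le hdegc x
    rw [Fintype.card_fin] at h
    set f := (univ.filter (fun y => e ≤ (nb G x ∩ nb G y).card)).card
    have h' : η ^ 2 * n ≤ f + e := by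
      have : (η ^ 2 * n) * n ≤ ((f:ℝ) + e) * n := by linarith
      exact le_of_mul_le_mul_right this hnpos
    rw [hb]
    refine Nat.ceil_le.2 ?_
    linarith
  · intro E hE
    obtain ⟨x, hx, y, hy, hne, h⟩ := F2 G η ξ hξ0.le r hξ1 (by rw [Fintype.card_fin]; omega) hdegc E hE
    refine ⟨x, hx, y, hy, hne, ?_⟩
    rw [Fintype.card_fin] at h
    rw [he]; exact Nat.ceil_le.2 h.le
  · rw [← hM0]
    have : (a:ℝ) + M0 < e := by linarith
    exact_mod_cast this
  · rw [← hM0, Fintype.card_fin]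
    have hb2 : η ^ 2 / 4 * n ≤ ((b - M0 : ℕ) : ℝ) := by
      have : (b:ℝ) ≤ ((b - M0 : ℕ) : ℝ) + M0 := by exact_mod_cast (by omega : b ≤ (b - M0) + M0)
      linarith
    have hd2 : η / 2 * n ≤ ((dm - M0 : ℕ) : ℝ) := by
      have : (dm:ℝ) ≤ ((dm - M0 : ℕ) : ℝ) + M0 := by exact_mod_cast (by omega : dm ≤ (dm - M0) + M0)
      linarith
    have : (a:ℝ) * n < ((b - M0 : ℕ) : ℝ) * ((dm - M0 : ℕ) : ℝ) := by
      calc (a:ℝ) * n ≤ (η ^ 3 / 16 * n) * n := by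
            gcongr
            exact ha'.trans (by gcongr)
        _ < (η ^ 2 / 4 * n) * (η / 2 * n) := by
            have : 0 < η ^ 3 * n * n := by positivity
            linarith
        _ ≤ _ := by gcongr
    exact_mod_cast this
  · intro Z hZ
    rw [← hM0] at hZ
    have hZ' : (Z.card:ℝ) ≤ M0 := by exact_mod_cast hZ
    have hle : a + Z.card ≤ dm := by
      have : (a:ℝ) + Z.card ≤ dm := by linarith
      exact_mod_cast this
    obtain ⟨U, hU1, hU2, hU3⟩ := max_tiling G q a hA Z (dm - (a + Z.card)) (fun x => by
      have := hdm2 x; omega)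
    refine ⟨U, hU1, hU2, ?_⟩
    rw [Fintype.card_fin] at hU3
    have h3 : ((q:ℝ) + 1) * (U.card * (dm - (a + Z.card))) ≤ n * (U.card + q * (a + q)) := by
      have : (((q + 1) * (U.card * (dm - (a + Z.card))) : ℕ) : ℝ) ≤
        ((n * (U.card + q * (a + q)) : ℕ) : ℝ) := by exact_mod_cast hU3
      push_cast [Nat.cast_sub hle] at this
      exact this
    have h4 : (η - ζ / 2) * n ≤ (dm:ℝ) - (a + Z.card) := by linarith
    have h5 : ((q:ℝ) + 1) * (U.card * ((η - ζ / 2) * n)) ≤ n * (U.card + q * (a + q)) :=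
      le_trans (by gcongr) h3
    have h6 : ((q:ℝ) + 1) * (U.card * (η - ζ / 2)) ≤ U.card + q * (a + q) := by
      refine le_of_mul_le_mul_right ?_ hnpos
      linarith
    have h7 : ((q:ℝ) + 1) * (U.card * ζ / 2) ≤ q * (a + q) := by
      have : ((q:ℝ) + 1) * (U.card * (η - ζ / 2)) = U.card * (((q:ℝ)+1) * η) - (q+1) * (U.card * ζ / 2) := by
        ring
      rw [this, hζη] at h6
      linarith
    rw [hL]
    refine Nat.le_floor ?_
    rw [le_div_iff₀ hζ0]
    have h8 : (q:ℝ) * (a + q) ≤ (q + 1) * (a + q) := by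
      have : (0:ℝ) ≤ a + q := by positivity
      linarith
    have h9 : (U.card:ℝ) * ζ / 2 ≤ a + q := by
      refine le_of_mul_le_mul_left (h7.trans h8) (by positivity)
    linarith
  · intro W N hWN hN
    rw [← hM0] at hWN
    have hWN' : (W.card:ℝ) + N ≤ M0 := by exact_mod_cast hWN
    refine reservoir G (η/2) (by positivity) (by linarith) W N p (fun x => ?_) (by rw [Fintype.card_fin]; omega)
      hp ?_
    · rw [Fintype.card_fin]
      have := hdeg x
      linarith
    · rw [Fintype.card_fin]
      exact lt_of_lt_of_le hn3 (Nat.pow_le_pow_right (by norm_num) hN)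
  · have hL' : (L:ℝ) ≤ 2 * ((a:ℝ) + q) / ζ := by rw [hL]; exact Nat.floor_le (by positivity)
    have : (a:ℝ) + q * L ≤ mb := by
      have h3 : (a:ℝ) + q * L ≤ a * κ + 2 * (q:ℝ) ^ 2 / ζ := by
        calc (a:ℝ) + q * L ≤ a + q * (2 * ((a:ℝ) + q) / ζ) := by gcongr
          _ = _ := by rw [hκ]; field_simp; ring
      have h4 : (a:ℝ) * κ ≤ γ / 2 * n := by
        calc (a:ℝ) * κ ≤ α * n * κ := by gcongr
          _ = α * κ * n := by ring
          _ ≤ _ := by gcongr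
      linarith
    exact_mod_cast this

end QT

namespace QT

theorem spans_of_clique {n k : ℕ} {G : SimpleGraph (Fin n)} {S : Finset (Fin n)}
    (h : G.IsNClique k S) : RTT.SpansCopy (⊤ : SimpleGraph (Fin k)) G S := by
  refine ⟨S.orderEmbOfFin h.card_eq, (S.orderEmbOfFin h.card_eq).injective, ?_, ?_⟩
  · intro a b hab
    exact h.isClique (S.orderEmbOfFin_mem h.card_eq a) (S.orderEmbOfFin_mem h.card_eq b)
      (fun he => hab ((S.orderEmbOfFin h.card_eq).injective he))
  · exact image_orderEmbOfFin_univ S h.card_eq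

end QT

open RTT in
/-- For every integer `k ≥ 3` and constant `1/k < η ≤ 1` there exists `α > 0`
such that for all sufficiently large `n`, every `n`-vertex graph `G` with `δ(G) ≥ ηn` and
`α_{k-1}(G) ≤ αn` contains a `K_k`-tiling covering all but at most `⌊1/η⌋(k-1)` vertices. -/
theorem quasiperfect_clique_tiling_alpha_k_sub_one :
    ∀ k : ℕ, 3 ≤ k → ∀ η : ℝ, 1 / (k : ℝ) < η → η ≤ 1 →
    ∃ α : ℝ, 0 < α ∧ ∃ N : ℕ, ∀ n : ℕ, N ≤ n →
      ∀ G : SimpleGraph (Fin n),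
        MinDegGE G (η * n) → IndepBound G (k - 1) (α * n) →
        ∃ T : Finset (Finset (Fin n)),
          IsTiling (⊤ : SimpleGraph (Fin k)) G T ∧
          (Finset.univ \ T.biUnion id).card ≤ ⌊1 / η⌋₊ * (k - 1) := by
  intro k hk η h1 h2
  obtain ⟨q, rfl⟩ : ∃ q, k = q + 1 := ⟨k - 1, by omega⟩
  obtain ⟨α, hα, N, hN⟩ := QT.final_real q η (by exact_mod_cast h1) h2
  refine ⟨α, hα, N, fun n hn G hd hi => ?_⟩
  obtain ⟨B, ⟨T, hT1, hT2, hT3⟩, hB⟩ := hN n hn G (fun x => by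
      have h := hd x
      have e : G.neighborSet x = (QT.nb G x : Set (Fin n)) := by
        ext y; simp [QT.mem_nb]
      rwa [e, Set.ncard_coe_finset] at h) (fun S hS => by
      by_contra hcon
      push Not at hcon
      have := hi S (by simpa using hcon)
      linarith)
  refine ⟨T, ⟨fun S hS => QT.spans_of_clique (hT1 S hS), hT2⟩, ?_⟩
  rw [hT3]
  simpa using hB
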